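/- Let d ≥ 2, let Λ ⊂ (0,1) be compact and γ ≥ 1. Let (A_ν, B_ν) be a sequence of pairs of Borel subsets of ℝ^d, and let (t_ν) be a convergent sequence in Λ. Suppose that |A_ν| → 1, |B_ν| → 1, and |t_ν A_ν + (1−t_ν)B_ν| → 1 as ν → ∞ (outer measure for sumsets), that A_ν and B_ν are γ-normalized for all ν, and that both sequences of indicator functions (𝟙_{A_ν^♮}) and (𝟙_{B_ν^♮}) converge in L²(ℝ^d). Then there exists a γ-normalized convex set 𝒞 ⊆ ℝ^d with |𝒞 △ 𝒞^♮| = 0 such that |A_ν^♮ △ 𝒞| → 0 and |B_ν^♮ △ 𝒞| → 0 as ν → ∞. -/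

import Mathlib

open MeasureTheory Set Pointwise Filter ENNReal

noncomputable section

abbrev Edim (n : ℕ) := EuclideanSpace ℝ (Fin n)

/-- We identify `ℝ^d` with `ℝ^{d-1} × ℝ`. -/
abbrev Sp (n : ℕ) := Edim n × ℝ

/-- The vertical slice `A_x ⊆ ℝ` of a set `A ⊆ ℝ^{n} × ℝ`. -/
def vslice {n : ℕ} (A : Set (Sp n)) (x : Edim n) : Set ℝ := {y | (x, y) ∈ A}

/-- The horizontal slice of `A ⊆ ℝ^n × ℝ` at height `t`. -/
def hslice {n : ℕ} (A : Set (Sp n)) (t : ℝ) : Set (Edim n) := {x | (x, t) ∈ A}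

/-- Steiner symmetrization `A^⋆`: the slice `(A^⋆)_x` is the open interval
`(-|A_x|/2, |A_x|/2)` centered at `0` of length `|A_x|` (empty if `|A_x| = 0`). -/
def steiner {n : ℕ} (A : Set (Sp n)) : Set (Sp n) :=
  {p | ENNReal.ofReal (2 * |p.2|) < volume (vslice A p.1)}

/-- Schwarz symmetrization `A^*`: the horizontal slice of `A^*` at height `t` is the open
ball in `ℝ^n` centered at `0` whose measure equals that of the corresponding slice of `A`. -/
def schwarz {n : ℕ} (A : Set (Sp n)) : Set (Sp n) :=
  {p | volume (Metric.ball (0 : Edim n) ‖p.1‖) < volume (hslice A p.2)}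

/-- The symmetrization `A^♮ = (A^⋆)^*`. -/
def natSymm {n : ℕ} (A : Set (Sp n)) : Set (Sp n) := schwarz (steiner A)


/-- A Borel set `A ⊆ ℝ^{d-1} × ℝ` is `γ`-normalized if `|A| ≥ γ⁻¹`,
`sup_x |A_x| ≤ γ`, and `|π(A)| ≤ γ`. -/
def IsNormalized {n : ℕ} (γ : ℝ) (A : Set (Sp n)) : Prop :=
  ENNReal.ofReal γ⁻¹ ≤ volume A ∧
  (⨆ x : Edim n, volume (vslice A x)) ≤ ENNReal.ofReal γ ∧
  volume (Prod.fst '' A) ≤ ENNReal.ofReal γ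

/-- Layer cake formula for `ℝ≥0∞`-valued functions. -/
theorem lintegral_meas_ofReal_lt {X : Type*} [MeasurableSpace X] (μ : Measure X) [SFinite μ]
    {u : X → ℝ≥0∞} (hu : Measurable u) :
    ∫⁻ s in Ioi (0 : ℝ), μ {x | ENNReal.ofReal s < u x} = ∫⁻ x, u x ∂μ := by
  have hT : MeasurableSet {p : X × ℝ | ENNReal.ofReal p.2 < u p.1} :=
    measurableSet_lt (ENNReal.measurable_ofReal.comp measurable_snd) (hu.comp measurable_fst)
  have h1 := Measure.prod_apply (μ := μ) (ν := volume.restrict (Ioi (0 : ℝ))) hT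
  have h2 := Measure.prod_apply_symm (μ := μ) (ν := volume.restrict (Ioi (0 : ℝ))) hT
  rw [h1] at h2
  refine h2.symm.trans (lintegral_congr fun x => ?_)
  have : Prod.mk x ⁻¹' {p : X × ℝ | ENNReal.ofReal p.2 < u p.1} = {s | ENNReal.ofReal s < u x} :=
    rfl
  rw [this, Measure.restrict_apply (measurableSet_lt ENNReal.measurable_ofReal measurable_const)]
  rcases eq_or_ne (u x) ⊤ with h | h
  · simp [h]
  · have : {s | ENNReal.ofReal s < u x} ∩ Ioi 0 = Ioo 0 (u x).toReal := by
      ext s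
      simp only [mem_inter_iff, mem_ofPred_eq, mem_Ioi, mem_Ioo]
      constructor
      · rintro ⟨a, b⟩
        exact ⟨b, (ENNReal.ofReal_lt_iff_lt_toReal b.le h).1 a⟩
      · rintro ⟨b, a⟩
        exact ⟨(ENNReal.ofReal_lt_iff_lt_toReal b.le h).2 a, b⟩
    rw [this, Real.volume_Ioo, sub_zero, ENNReal.ofReal_toReal h]

theorem IsCompact.volume_add_le_volume_add {K L : Set ℝ} (hK : IsCompact K) (hL : IsCompact L)
    (hKn : K.Nonempty) (hLn : L.Nonempty) : volume K + volume L ≤ volume (K + L) := by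
  obtain ⟨a, ha, hamax⟩ := hK.exists_isGreatest hKn
  obtain ⟨b, hb, hbmin⟩ := hL.exists_isLeast hLn
  have e1 : volume K = volume ((fun x => x + -b) ⁻¹' K) := (measure_preimage_add_right _ _ _).symm
  have e2 : volume L = volume ((fun x => -a + x) ⁻¹' L) := (measure_preimage_add _ _ _).symm
  rw [e1, e2]
  rw [← measure_union₀]
  · apply measure_mono
    rintro x (hx | hx)
    · exact ⟨x + -b, hx, b, hb, by simp⟩
    · exact ⟨a, ha, -a + x, hx, by simp⟩
  · exact ((measurable_const_add _) hL.measurableSet).nullMeasurableSet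
  · refine measure_mono_null (t := {a + b}) ?_ (by simp)
    rintro x ⟨hx, hy⟩
    have h1 := hamax hx
    have h2 := hbmin hy
    simp only [mem_singleton_iff]
    linarith

/-- The Brunn-Minkowski inequality on the real line. -/
theorem volume_add_le_volume_smul_add_smul {P Q : Set ℝ} (hP : MeasurableSet P)
    (hQ : MeasurableSet Q) (hPn : P.Nonempty) (hQn : Q.Nonempty) {t : ℝ} (ht0 : 0 < t)
    (ht1 : t < 1) :
    ENNReal.ofReal t * volume P + ENNReal.ofReal (1 - t) * volume Q
      ≤ volume (t • P + (1 - t) • Q) := by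
  have hs : 0 < 1 - t := by linarith
  have key : ∀ {P Q : Set ℝ}, MeasurableSet P → MeasurableSet Q → P.Nonempty → Q.Nonempty →
      volume P + volume Q ≤ volume (P + Q) := by
    intro P Q hP hQ hPn hQn
    obtain ⟨p, hp⟩ := hPn
    obtain ⟨q, hq⟩ := hQn
    rw [hP.measure_eq_iSup_isCompact, hQ.measure_eq_iSup_isCompact]
    simp_rw [iSup_and']
    refine ENNReal.biSup_add_biSup_le' ⟨∅, by simp⟩ ⟨∅, by simp⟩ ?_
    rintro K ⟨hKP, hK⟩ L ⟨hLQ, hL⟩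
    calc volume K + volume L ≤ volume (insert p K) + volume (insert q L) := by
          gcongr <;> exact subset_insert _ _
      _ ≤ volume (insert p K + insert q L) :=
          (hK.insert p).volume_add_le_volume_add (hL.insert q) (insert_nonempty _ _)
            (insert_nonempty _ _)
      _ ≤ volume (P + Q) := by
          gcongr
          · exact insert_subset hp hKP
          · exact insert_subset hq hLQ
  have h1 := key (hP.const_smul_of_ne_zero ht0.ne') (hQ.const_smul_of_ne_zero hs.ne')
    hPn.smul_set hQn.smul_set
  rw [Measure.addHaar_smul, Measure.addHaar_smul] at h1
  simpa [abs_of_pos ht0, abs_of_pos hs] using h1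

theorem measurable_meas_ofReal_lt {X : Type*} [MeasurableSpace X] (μ : Measure X)
    (u : X → ℝ≥0∞) : Measurable fun s : ℝ => μ {x | ENNReal.ofReal s < u x} :=
  Antitone.measurable fun _ _ hab => measure_mono fun _ hx =>
    (ENNReal.ofReal_le_ofReal hab).trans_lt hx

/-- The strong form of the one-dimensional Prékopa–Leindler inequality for functions with
supremum `1`. -/
theorem prekopa_leindler_of_sup_eq_one {f g h : ℝ → ℝ≥0∞} (hf : Measurable f) (hg : Measurable g)
    (hh : Measurable h) {t : ℝ} (ht0 : 0 < t) (ht1 : t < 1)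
    (hf1 : ∀ x, f x ≤ 1) (hg1 : ∀ x, g x ≤ 1)
    (hfs : ∀ s : ℝ, s < 1 → ∃ x, ENNReal.ofReal s < f x)
    (hgs : ∀ s : ℝ, s < 1 → ∃ x, ENNReal.ofReal s < g x)
    (H : ∀ a b s : ℝ, ENNReal.ofReal s < f a → ENNReal.ofReal s < g b →
      ENNReal.ofReal s < h (t * a + (1 - t) * b)) :
    ENNReal.ofReal t * (∫⁻ x, f x) + ENNReal.ofReal (1 - t) * ∫⁻ x, g x ≤ ∫⁻ x, h x := by
  rw [← lintegral_meas_ofReal_lt volume hf, ← lintegral_meas_ofReal_lt volume hg,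
    ← lintegral_meas_ofReal_lt volume hh,
    ← lintegral_const_mul _ (measurable_meas_ofReal_lt _ _),
    ← lintegral_const_mul _ (measurable_meas_ofReal_lt _ _),
    ← lintegral_add_left ((measurable_meas_ofReal_lt _ _).const_mul _)]
  refine setLIntegral_mono' measurableSet_Ioi fun s _ => ?_
  rcases lt_or_ge s 1 with hs1 | hs1
  · refine (volume_add_le_volume_smul_add_smul (measurableSet_lt measurable_const hf)
      (measurableSet_lt measurable_const hg) (hfs s hs1) (hgs s hs1) ht0 ht1).trans ?_
    apply measure_mono
    rintro _ ⟨_, ⟨a, ha, rfl⟩, _, ⟨b, hb, rfl⟩, rfl⟩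
    exact H a b s ha hb
  · have h0 : ∀ u : ℝ → ℝ≥0∞, (∀ x, u x ≤ 1) → {x | ENNReal.ofReal s < u x} = ∅ := by
      intro u hu
      ext x
      simp only [mem_ofPred_eq, mem_empty_iff_false, iff_false, not_lt]
      exact (hu x).trans (by simpa using hs1)
    simp [h0 f hf1, h0 g hg1]

/-- The strong form of the one-dimensional Prékopa–Leindler inequality. -/
theorem prekopa_leindler_strong {f g h : ℝ → ℝ≥0∞} (hf : Measurable f) (hg : Measurable g)
    (hh : Measurable h) {t : ℝ} (ht0 : 0 < t) (ht1 : t < 1) {α β : ℝ} (hα : 0 < α) (hβ : 0 < β)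
    (hf1 : ∀ x, f x ≤ ENNReal.ofReal α) (hg1 : ∀ x, g x ≤ ENNReal.ofReal β)
    (hfs : ∀ s : ℝ, s < α → ∃ x, ENNReal.ofReal s < f x)
    (hgs : ∀ s : ℝ, s < β → ∃ x, ENNReal.ofReal s < g x)
    (H : ∀ a b, f a ^ t * g b ^ (1 - t) ≤ h (t * a + (1 - t) * b)) :
    ENNReal.ofReal (α ^ t * β ^ (1 - t)) *
      (ENNReal.ofReal (t / α) * (∫⁻ x, f x) + ENNReal.ofReal ((1 - t) / β) * ∫⁻ x, g x)
      ≤ ∫⁻ x, h x := by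
  have hs : 0 < 1 - t := by linarith
  set c := α ^ t * β ^ (1 - t) with hc
  have hc0 : 0 < c := by positivity
  have hlt : ∀ {u s : ℝ} {y : ℝ≥0∞}, 0 < u →
      (ENNReal.ofReal s < ENNReal.ofReal u⁻¹ * y ↔ ENNReal.ofReal (u * s) < y) := by
    intro u s y hu
    rw [ENNReal.ofReal_mul hu.le, ENNReal.ofReal_inv_of_pos hu, mul_comm, ← div_eq_mul_inv,
      ENNReal.lt_div_iff_mul_lt (by simp [hu]) (by simp), mul_comm]
  have hle : ∀ {u : ℝ} {y : ℝ≥0∞}, 0 < u → y ≤ ENNReal.ofReal u → ENNReal.ofReal u⁻¹ * y ≤ 1 := by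
    intro u y hu hy
    calc ENNReal.ofReal u⁻¹ * y ≤ ENNReal.ofReal u⁻¹ * ENNReal.ofReal u := by gcongr
      _ = 1 := by rw [← ENNReal.ofReal_mul (by positivity), inv_mul_cancel₀ hu.ne']; simp
  have key := prekopa_leindler_of_sup_eq_one (f := fun x => ENNReal.ofReal α⁻¹ * f x)
    (g := fun x => ENNReal.ofReal β⁻¹ * g x) (h := fun x => ENNReal.ofReal c⁻¹ * h x)
    (hf.const_mul _) (hg.const_mul _) (hh.const_mul _) ht0 ht1
    (fun x => hle hα (hf1 x)) (fun x => hle hβ (hg1 x))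
    (fun s hs => by
      simp only [hlt hα]
      exact hfs _ (by nlinarith))
    (fun s hs => by
      simp only [hlt hβ]
      exact hgs _ (by nlinarith))
    (by
      intro a b s ha hb
      rcases le_or_gt s 0 with hs0 | hs0
      · rw [ENNReal.ofReal_of_nonpos hs0] at ha hb ⊢
        have ha' : 0 < f a := pos_of_mul_pos_right ha (by simp)
        have hb' : 0 < g b := pos_of_mul_pos_right hb (by simp)
        refine ENNReal.mul_pos (by simp [hc0]) (ne_of_gt (lt_of_lt_of_le ?_ (H a b)))
        have e1 := ENNReal.rpow_pos ha' ((hf1 a).trans_lt (by simp)).ne (p := t)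
        have e2 := ENNReal.rpow_pos hb' ((hg1 b).trans_lt (by simp)).ne (p := 1 - t)
        exact ENNReal.mul_pos e1.ne' e2.ne'
      · rw [hlt hα] at ha
        rw [hlt hβ] at hb
        rw [hlt hc0]
        refine lt_of_lt_of_le ?_ (H a b)
        have e : c * s = (α * s) ^ t * (β * s) ^ (1 - t) := by
          rw [Real.mul_rpow hα.le hs0.le, Real.mul_rpow hβ.le hs0.le, hc]
          have : s ^ t * s ^ (1 - t) = s := by rw [← Real.rpow_add hs0]; simp
          linear_combination (-(α ^ t * β ^ (1 - t))) * this
        rw [e, ENNReal.ofReal_mul (by positivity), ← ENNReal.ofReal_rpow_of_pos (by positivity),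
          ← ENNReal.ofReal_rpow_of_pos (by positivity)]
        exact ENNReal.mul_lt_mul (ENNReal.rpow_lt_rpow ha ht0) (ENNReal.rpow_lt_rpow hb hs))
  rw [lintegral_const_mul _ hf, lintegral_const_mul _ hg, lintegral_const_mul _ hh] at key
  calc _ = ENNReal.ofReal c * (ENNReal.ofReal t * (ENNReal.ofReal α⁻¹ * ∫⁻ x, f x) +
        ENNReal.ofReal (1 - t) * (ENNReal.ofReal β⁻¹ * ∫⁻ x, g x)) := by
        rw [div_eq_mul_inv, div_eq_mul_inv, ENNReal.ofReal_mul ht0.le, ENNReal.ofReal_mul hs.le,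
          mul_assoc, mul_assoc]
    _ ≤ ENNReal.ofReal c * (ENNReal.ofReal c⁻¹ * ∫⁻ x, h x) := by gcongr
    _ = ∫⁻ x, h x := by
        rw [← mul_assoc, ← ENNReal.ofReal_mul hc0.le, mul_inv_cancel₀ hc0.ne']; simp

/-- The geometric (multiplicative) Brunn-Minkowski inequality passes from `V` to `ℝ × V`. -/
theorem geometric_brunn_minkowski_prod {V : Type*} [NormedAddCommGroup V] [NormedSpace ℝ V]
    [MeasurableSpace V] [BorelSpace V] [SecondCountableTopology V] (μ : Measure V) [SigmaFinite μ]
    [IsFiniteMeasureOnCompacts μ] {t : ℝ} (ht0 : 0 < t) (ht1 : t < 1)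
    (hV : ∀ P Q : Set V, IsCompact P → IsCompact Q →
      μ P ^ t * μ Q ^ (1 - t) ≤ μ (t • P + (1 - t) • Q))
    {P Q : Set (ℝ × V)} (hP : IsCompact P) (hQ : IsCompact Q) :
    (volume.prod μ) P ^ t * (volume.prod μ) Q ^ (1 - t)
      ≤ (volume.prod μ) (t • P + (1 - t) • Q) := by
  have hs : 0 < 1 - t := by linarith
  have slice_compact : ∀ {P : Set (ℝ × V)} (y : ℝ), IsCompact P → IsCompact (Prod.mk y ⁻¹' P) := by
    intro P y hP
    have : Prod.mk y ⁻¹' P = Prod.snd '' (P ∩ Prod.fst ⁻¹' {y}) := by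
      ext x
      constructor
      · intro hx
        exact ⟨(y, x), ⟨hx, rfl⟩, rfl⟩
      · rintro ⟨⟨y', x'⟩, ⟨h1, h2⟩, rfl⟩
        obtain rfl : y' = y := h2
        exact h1
    rw [this]
    exact (hP.inter_right (isClosed_singleton.preimage continuous_fst)).image continuous_snd
  have slice_le : ∀ {P : Set (ℝ × V)} (y : ℝ), μ (Prod.mk y ⁻¹' P) ≤ μ (Prod.snd '' P) :=
    fun {P} y => measure_mono fun x hx => ⟨(y, x), hx, rfl⟩
  have hK : IsCompact (t • P + (1 - t) • Q) := (hP.smul t).add (hQ.smul (1 - t))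
  have sup_fin : ∀ {P : Set (ℝ × V)}, IsCompact P → (⨆ y, μ (Prod.mk y ⁻¹' P)) ≠ ⊤ := fun hP =>
    ((iSup_le fun y => slice_le y).trans_lt (hP.image continuous_snd).measure_lt_top).ne
  have hPtop : (volume.prod μ) P ≠ ⊤ := hP.measure_lt_top.ne
  have hQtop : (volume.prod μ) Q ≠ ⊤ := hQ.measure_lt_top.ne
  rw [Measure.prod_apply hP.measurableSet] at hPtop ⊢
  rw [Measure.prod_apply hQ.measurableSet] at hQtop ⊢
  rw [Measure.prod_apply hK.measurableSet]
  set f : ℝ → ℝ≥0∞ := fun y => μ (Prod.mk y ⁻¹' P) with hf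
  set g : ℝ → ℝ≥0∞ := fun y => μ (Prod.mk y ⁻¹' Q) with hg
  rcases eq_or_ne (⨆ y, f y) 0 with h0 | hα
  · have : ∫⁻ y, f y = 0 := by
      simp only [ENNReal.iSup_eq_zero] at h0
      simp [h0]
    rw [this, ENNReal.zero_rpow_of_pos ht0, zero_mul]
    exact zero_le
  rcases eq_or_ne (⨆ y, g y) 0 with h0 | hβ
  · have : ∫⁻ y, g y = 0 := by
      simp only [ENNReal.iSup_eq_zero] at h0
      simp [h0]
    rw [this, ENNReal.zero_rpow_of_pos hs, mul_zero]
    exact zero_le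
  have hα0 : 0 < (⨆ y, f y).toReal := ENNReal.toReal_pos hα (sup_fin hP)
  have hβ0 : 0 < (⨆ y, g y).toReal := ENNReal.toReal_pos hβ (sup_fin hQ)
  have exlt : ∀ {f : ℝ → ℝ≥0∞}, (⨆ y, f y) ≠ ⊤ → 0 < (⨆ y, f y).toReal → ∀ s : ℝ,
      s < (⨆ y, f y).toReal → ∃ x, ENNReal.ofReal s < f x := by
    intro f h1 h2 s hs
    apply lt_iSup_iff.1
    rw [← ENNReal.ofReal_toReal h1]
    exact (ENNReal.ofReal_lt_ofReal_iff h2).2 hs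
  have key := prekopa_leindler_strong (measurable_measure_prodMk_left hP.measurableSet)
    (measurable_measure_prodMk_left hQ.measurableSet)
    (measurable_measure_prodMk_left (ν := μ) hK.measurableSet) ht0 ht1 hα0 hβ0
    (fun x => by rw [ENNReal.ofReal_toReal (sup_fin hP)]; exact le_iSup f x)
    (fun x => by rw [ENNReal.ofReal_toReal (sup_fin hQ)]; exact le_iSup g x)
    (exlt (sup_fin hP) hα0) (exlt (sup_fin hQ) hβ0)
    (by
      intro a b
      refine (hV _ _ (slice_compact a hP) (slice_compact b hQ)).trans (measure_mono ?_)
      rintro _ ⟨_, ⟨p, hp, rfl⟩, _, ⟨q, hq, rfl⟩, rfl⟩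
      exact ⟨_, ⟨(a, p), hp, rfl⟩, _, ⟨(b, q), hq, rfl⟩, rfl⟩)
  refine le_trans ?_ key
  generalize (⨆ y, f y).toReal = α at hα0
  generalize (⨆ y, g y).toReal = β at hβ0
  change (∫⁻ y, f y) ^ t * (∫⁻ y, g y) ^ (1 - t) ≤ ENNReal.ofReal (α ^ t * β ^ (1 - t)) *
      (ENNReal.ofReal (t / α) * (∫⁻ y, f y) + ENNReal.ofReal ((1 - t) / β) * (∫⁻ y, g y))
  rw [← ENNReal.ofReal_toReal hPtop, ← ENNReal.ofReal_toReal hQtop]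
  generalize (∫⁻ y, f y).toReal = p, ENNReal.toReal_nonneg (a := ∫⁻ y, f y) = hp
  generalize (∫⁻ y, g y).toReal = q, ENNReal.toReal_nonneg (a := ∫⁻ y, g y) = hq
  rw [ENNReal.ofReal_rpow_of_nonneg hp ht0.le, ENNReal.ofReal_rpow_of_nonneg hq hs.le,
    ← ENNReal.ofReal_mul (by positivity), ← ENNReal.ofReal_mul (by positivity),
    ← ENNReal.ofReal_mul (by positivity), ← ENNReal.ofReal_add (by positivity) (by positivity),
    ← ENNReal.ofReal_mul (by positivity)]
  apply ENNReal.ofReal_le_ofReal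
  have := Real.geom_mean_le_arith_mean2_weighted ht0.le hs.le (p₁ := p / α) (p₂ := q / β)
    (by positivity) (by positivity) (by ring)
  rw [Real.div_rpow hp hα0.le, Real.div_rpow hq hβ0.le] at this
  calc p ^ t * q ^ (1 - t) = α ^ t * β ^ (1 - t) * (p ^ t / α ^ t * (q ^ (1 - t) / β ^ (1 - t))) := by
        field_simp
    _ ≤ α ^ t * β ^ (1 - t) * (t * (p / α) + (1 - t) * (q / β)) := by gcongr
    _ = _ := by ring

theorem geometric_brunn_minkowski_pi (n : ℕ) {t : ℝ} (ht0 : 0 < t) (ht1 : t < 1)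
    {P Q : Set (Fin n → ℝ)} (hP : IsCompact P) (hQ : IsCompact Q) :
    volume P ^ t * volume Q ^ (1 - t) ≤ volume (t • P + (1 - t) • Q) := by
  have hs : 0 < 1 - t := by linarith
  induction n with
  | zero =>
    rcases P.eq_empty_or_nonempty with rfl | hPn
    · simp [ht0]
    rcases Q.eq_empty_or_nonempty with rfl | hQn
    · simp [hs]
    have h : ∀ S : Set (Fin 0 → ℝ), S.Nonempty → volume S = 1 := by
      intro S hS
      rw [Subsingleton.eq_univ_of_nonempty hS, volume_pi, Measure.pi_univ]
      simp
    rw [h P hPn, h Q hQn, h _ (hPn.smul_set.add hQn.smul_set)]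
    simp
  | succ n ih =>
    have e := volume_preserving_piFinSuccAbove (fun _ : Fin (n + 1) => ℝ) 0
    set φ := MeasurableEquiv.piFinSuccAbove (fun _ : Fin (n + 1) => ℝ) 0 with hφ
    have hφc : Continuous φ := by
      rw [hφ]
      simp only [MeasurableEquiv.piFinSuccAbove]
      exact (continuous_apply _).prodMk (continuous_pi fun j => continuous_apply _)
    have hvol : ∀ S : Set (Fin (n + 1) → ℝ), volume S = (volume.prod volume) (φ '' S) := by
      intro S
      rw [← Measure.volume_eq_prod, ← e.measure_preimage_equiv (φ '' S), φ.preimage_image]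
    have hadd : φ '' (t • P + (1 - t) • Q) = t • (φ '' P) + (1 - t) • (φ '' Q) := by
      ext y
      constructor
      · rintro ⟨_, ⟨_, ⟨p, hp, rfl⟩, _, ⟨q, hq, rfl⟩, rfl⟩, rfl⟩
        exact ⟨_, ⟨_, ⟨p, hp, rfl⟩, rfl⟩, _, ⟨_, ⟨q, hq, rfl⟩, rfl⟩, rfl⟩
      · rintro ⟨_, ⟨_, ⟨p, hp, rfl⟩, rfl⟩, _, ⟨_, ⟨q, hq, rfl⟩, rfl⟩, rfl⟩
        exact ⟨_, ⟨_, ⟨p, hp, rfl⟩, _, ⟨q, hq, rfl⟩, rfl⟩, rfl⟩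
    rw [hvol P, hvol Q, hvol, hadd]
    exact geometric_brunn_minkowski_prod volume ht0 ht1 (fun P Q hP hQ => ih hP hQ)
      (hP.image hφc) (hQ.image hφc)

theorem geometric_brunn_minkowski (n : ℕ) {t : ℝ} (ht0 : 0 < t) (ht1 : t < 1)
    {P Q : Set (Edim n)} (hP : IsCompact P) (hQ : IsCompact Q) :
    volume P ^ t * volume Q ^ (1 - t) ≤ volume (t • P + (1 - t) • Q) := by
  have e := EuclideanSpace.volume_preserving_symm_measurableEquiv_toLp (Fin n)
  set φ := (MeasurableEquiv.toLp 2 (Fin n → ℝ)).symm with hφ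
  have hφc : Continuous φ := PiLp.continuous_ofLp 2 _
  have hvol : ∀ S : Set (Edim n), volume S = volume (φ '' S) := by
    intro S
    rw [← e.measure_preimage_equiv (φ '' S), φ.preimage_image]
  have hadd : φ '' (t • P + (1 - t) • Q) = t • (φ '' P) + (1 - t) • (φ '' Q) := by
    ext y
    constructor
    · rintro ⟨_, ⟨_, ⟨p, hp, rfl⟩, _, ⟨q, hq, rfl⟩, rfl⟩, rfl⟩
      exact ⟨_, ⟨_, ⟨p, hp, rfl⟩, rfl⟩, _, ⟨_, ⟨q, hq, rfl⟩, rfl⟩, rfl⟩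
    · rintro ⟨_, ⟨_, ⟨p, hp, rfl⟩, rfl⟩, _, ⟨_, ⟨q, hq, rfl⟩, rfl⟩, rfl⟩
      exact ⟨_, ⟨_, ⟨p, hp, rfl⟩, _, ⟨q, hq, rfl⟩, rfl⟩, rfl⟩
  rw [hvol P, hvol Q, hvol, hadd]
  exact geometric_brunn_minkowski_pi n ht0 ht1 (hP.image hφc) (hQ.image hφc)

/-- The `n`-th power of the weighted arithmetic mean of `n`-th roots, as on the right-hand side of
the Brunn-Minkowski inequality in `ℝⁿ`. -/
def rootMean (n : ℕ) (t v w : ℝ) : ℝ :=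
  (t * v ^ (n : ℝ)⁻¹ + (1 - t) * w ^ (n : ℝ)⁻¹) ^ n

theorem brunn_minkowski_of_isCompact {n : ℕ} (hn : n ≠ 0) {t : ℝ} (ht0 : 0 < t) (ht1 : t < 1)
    {P Q : Set (Edim n)} (hP : IsCompact P) (hQ : IsCompact Q) {v w : ℝ} (hv : 0 < v) (hw : 0 < w)
    (hPv : volume P = ENNReal.ofReal v) (hQw : volume Q = ENNReal.ofReal w) :
    ENNReal.ofReal (rootMean n t v w) ≤ volume (t • P + (1 - t) • Q) := by
  have hs : 0 < 1 - t := by linarith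
  unfold rootMean
  set p := v ^ (n : ℝ)⁻¹ with hp
  set q := w ^ (n : ℝ)⁻¹ with hq
  have hp0 : 0 < p := by positivity
  have hq0 : 0 < q := by positivity
  have hpn : p ^ n = v := Real.rpow_inv_natCast_pow hv.le hn
  have hqn : q ^ n = w := Real.rpow_inv_natCast_pow hw.le hn
  set r := t * p + (1 - t) * q with hr
  have hr0 : 0 < r := by positivity
  have hfin : Module.finrank ℝ (Edim n) = n := by simp
  have hunit : ∀ {S : Set (Edim n)} {u v : ℝ}, 0 < u → u ^ n = v → volume S = ENNReal.ofReal v →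
      volume (u⁻¹ • S) = 1 := by
    intro S u v hu huv hS
    rw [Measure.addHaar_smul, hfin, hS, ← huv, ← ENNReal.ofReal_mul (by positivity)]
    rw [abs_of_pos (by positivity), ← mul_pow, inv_mul_cancel₀ hu.ne']
    simp
  have h1 : 0 < t * p / r := by positivity
  have h2 : 1 - t * p / r = (1 - t) * q / r := by
    field_simp
    rw [hr]; ring
  have h3 : t * p / r < 1 := by
    have : 0 < (1 - t) * q / r := by positivity
    linarith
  have key := geometric_brunn_minkowski n h1 h3 (hP.smul p⁻¹) (hQ.smul q⁻¹)
  rw [hunit hp0 hpn hPv, hunit hq0 hqn hQw, h2, smul_smul, smul_smul] at key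
  have e1 : t * p / r * p⁻¹ = r⁻¹ * t := by field_simp
  have e2 : (1 - t) * q / r * q⁻¹ = r⁻¹ * (1 - t) := by field_simp
  rw [e1, e2, mul_smul, mul_smul, ← smul_add, Measure.addHaar_smul, hfin,
    abs_of_pos (by positivity)] at key
  simp only [ENNReal.one_rpow, mul_one] at key
  calc ENNReal.ofReal (r ^ n) = ENNReal.ofReal (r ^ n) * 1 := by simp
    _ ≤ ENNReal.ofReal (r ^ n) * (ENNReal.ofReal (r⁻¹ ^ n) * volume (t • P + (1 - t) • Q)) := by
        gcongr
    _ = _ := by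
        rw [← mul_assoc, ← ENNReal.ofReal_mul (by positivity), ← mul_pow, mul_inv_cancel₀ hr0.ne']
        simp

theorem rootMean_le_rootMean (n : ℕ) {t v w v' w' : ℝ} (ht0 : 0 < t) (ht1 : t < 1)
    (hv : 0 ≤ v) (hw : 0 ≤ w) (hv' : v ≤ v') (hw' : w ≤ w') :
    rootMean n t v w ≤ rootMean n t v' w' := by
  have hs : 0 < 1 - t := by linarith
  unfold rootMean
  gcongr

/-- The Brunn-Minkowski inequality in `ℝⁿ`. -/
theorem brunn_minkowski {n : ℕ} (hn : n ≠ 0) {t : ℝ} (ht0 : 0 < t) (ht1 : t < 1)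
    {P Q : Set (Edim n)} (hP : MeasurableSet P) (hQ : MeasurableSet Q) {v w : ℝ} (hv : 0 ≤ v)
    (hw : 0 ≤ w) (hPv : ENNReal.ofReal v < volume P) (hQw : ENNReal.ofReal w < volume Q) :
    ENNReal.ofReal (rootMean n t v w) ≤ volume (t • P + (1 - t) • Q) := by
  obtain ⟨K, hKP, hK, hvK⟩ := hP.exists_lt_isCompact hPv
  obtain ⟨L, hLQ, hL, hwL⟩ := hQ.exists_lt_isCompact hQw
  have hKtop := hK.measure_lt_top (μ := volume) |>.ne
  have hLtop := hL.measure_lt_top (μ := volume) |>.ne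
  have h1 := (ENNReal.ofReal_lt_iff_lt_toReal hv hKtop).1 hvK
  have h2 := (ENNReal.ofReal_lt_iff_lt_toReal hw hLtop).1 hwL
  calc ENNReal.ofReal (rootMean n t v w)
      ≤ ENNReal.ofReal (rootMean n t (volume K).toReal (volume L).toReal) :=
        ENNReal.ofReal_le_ofReal (rootMean_le_rootMean n ht0 ht1 hv hw h1.le h2.le)
    _ ≤ volume (t • K + (1 - t) • L) :=
        brunn_minkowski_of_isCompact hn ht0 ht1 hK hL (hv.trans_lt h1) (hw.trans_lt h2)
          (ENNReal.ofReal_toReal hKtop).symm (ENNReal.ofReal_toReal hLtop).symm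
    _ ≤ _ := by gcongr

/-- A right-continuous nonincreasing function on `[0, ∞)` (extended to `ℝ`) with values in `[0, γ]`,
vanishing on `[γ, ∞)`, and with unit integral over `(0, ∞)`. -/
structure IsProfile (γ : ℝ) (f : ℝ → ℝ) : Prop where
  antitone : Antitone f
  nonneg : ∀ s, 0 ≤ f s
  le : ∀ s, f s ≤ γ
  eq_zero : ∀ s, γ ≤ s → f s = 0
  exists_gt : ∀ a v, v < f a → ∃ a' > a, v < f a'
  lintegral_eq_one : ∫⁻ s in Ioi (0 : ℝ), ENNReal.ofReal (f s) = 1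

namespace IsProfile

variable {γ : ℝ} {f g : ℝ → ℝ}

theorem measurable (hf : IsProfile γ f) : Measurable fun x => ENNReal.ofReal (f x) :=
  ENNReal.measurable_ofReal.comp hf.antitone.measurable

theorem lintegral_Ico (hf : IsProfile γ f) {a : ℝ} (ha : 0 ≤ a) :
    ∫⁻ x in Ico 0 a, ENNReal.ofReal (f x) = ENNReal.ofReal (∫ x in (0)..a, f x) := by
  rw [intervalIntegral.integral_of_le ha, setLIntegral_congr Ico_ae_eq_Ioc,
    ofReal_integral_eq_lintegral_ofReal]
  · exact (hf.antitone.intervalIntegrable (a := 0) (b := a)).1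
  · exact Eventually.of_forall hf.nonneg

theorem lintegral_Ico_add_Ici (k : ℝ → ℝ≥0∞) {a : ℝ} (ha : 0 ≤ a) :
    (∫⁻ x in Ico 0 a, k x) + ∫⁻ x in Ici a, k x = ∫⁻ x in Ioi (0 : ℝ), k x := by
  rw [setLIntegral_congr (Ioi_ae_eq_Ici (a := (0 : ℝ))), ← Ico_union_Ici_eq_Ici ha,
    lintegral_union measurableSet_Ici]
  exact Set.disjoint_left.2 fun x hx hx' => hx.2.not_ge hx'

theorem integral_le_one (hf : IsProfile γ f) {a : ℝ} (ha : 0 ≤ a) : ∫ x in (0)..a, f x ≤ 1 := by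
  have h := lintegral_Ico_add_Ici (fun x => ENNReal.ofReal (f x)) ha
  rw [hf.lintegral_eq_one, hf.lintegral_Ico ha] at h
  have : ENNReal.ofReal (∫ x in (0)..a, f x) ≤ ENNReal.ofReal 1 := by
    rw [ENNReal.ofReal_one, ← h]; exact le_self_add
  exact (ENNReal.ofReal_le_ofReal_iff zero_le_one).1 this

theorem integral_nonneg (hf : IsProfile γ f) {a : ℝ} (ha : 0 ≤ a) : 0 ≤ ∫ x in (0)..a, f x :=
  intervalIntegral.integral_nonneg ha fun x _ => hf.nonneg x

theorem lintegral_Ici (hf : IsProfile γ f) {a : ℝ} (ha : 0 ≤ a) :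
    ∫⁻ x in Ici a, ENNReal.ofReal (f x) = ENNReal.ofReal (1 - ∫ x in (0)..a, f x) := by
  have h := lintegral_Ico_add_Ici (fun x => ENNReal.ofReal (f x)) ha
  rw [hf.lintegral_eq_one, hf.lintegral_Ico ha] at h
  rw [ENNReal.ofReal_sub _ (hf.integral_nonneg ha), ENNReal.ofReal_one, ← h,
    ENNReal.add_sub_cancel_left (by simp)]

theorem pos_of_integral_lt_one (hf : IsProfile γ f) {a : ℝ} (ha : 0 ≤ a)
    (h : ∫ x in (0)..a, f x < 1) : 0 < f a := by
  by_contra h0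
  have h0 : f a ≤ 0 := not_lt.1 h0
  have : ∫⁻ x in Ici a, ENNReal.ofReal (f x) = 0 := by
    rw [← lintegral_zero (μ := volume.restrict (Ici a))]
    refine setLIntegral_congr_fun measurableSet_Ici fun x hx => ?_
    exact ENNReal.ofReal_of_nonpos ((hf.antitone hx).trans h0)
  rw [hf.lintegral_Ici ha] at this
  simp only [ENNReal.ofReal_eq_zero] at this
  linarith

theorem integral_lt_one_of_pos (hf : IsProfile γ f) {a : ℝ} (ha : 0 ≤ a) (h : 0 < f a) :
    ∫ x in (0)..a, f x < 1 := by
  obtain ⟨a', ha', h'⟩ := hf.exists_gt a 0 h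
  have h1 := hf.integral_le_one (ha.trans ha'.le)
  rw [← intervalIntegral.integral_add_adjacent_intervals (b := a)
    hf.antitone.intervalIntegrable hf.antitone.intervalIntegrable] at h1
  have h2 : ∫ _ in a..a', f a' ≤ ∫ x in a..a', f x :=
    intervalIntegral.integral_mono_on ha'.le (by simp) hf.antitone.intervalIntegrable
      fun x hx => hf.antitone hx.2
  simp only [intervalIntegral.integral_const, smul_eq_mul] at h2
  have : 0 < (a' - a) * f a' := mul_pos (sub_pos.2 ha') h'
  linarith

theorem continuous_integral (hf : IsProfile γ f) : Continuous fun a => ∫ x in (0)..a, f x :=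
  intervalIntegral.continuous_primitive (fun _ _ => hf.antitone.intervalIntegrable) 0

theorem integral_le_integral (hf : IsProfile γ f) (hg : IsProfile γ g)
    (hcut : ∀ a b, 0 ≤ a → 0 ≤ b → ∫ x in (0)..a, f x = ∫ x in (0)..b, g x →
      ∫ x in (0)..a, f x < 1 → f a = g b) {a : ℝ} (ha : 0 ≤ a) :
    ∫ x in (0)..a, g x ≤ ∫ x in (0)..a, f x := by
  by_contra hW
  have hW : ∫ x in (0)..a, f x < ∫ x in (0)..a, g x := not_le.1 hW
  have hZc : IsCompact (Icc 0 a ∩ {x | ∫ y in (0)..x, g y ≤ ∫ y in (0)..x, f y}) :=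
    isCompact_Icc.inter_right (isClosed_le hg.continuous_integral hf.continuous_integral)
  obtain ⟨c, ⟨hc, hcZ⟩, hmax⟩ := hZc.exists_isGreatest ⟨0, ⟨le_rfl, ha⟩, by simp⟩
  have hle : ∀ x ∈ Ioo c a, g x ≤ f x := by
    intro x hx
    have hx0 : 0 ≤ x := hc.1.trans hx.1.le
    have hlt : ∫ y in (0)..x, f y < ∫ y in (0)..x, g y := by
      by_contra h
      exact hx.1.not_ge (hmax ⟨⟨hx0, hx.2.le⟩, not_lt.1 h⟩)
    obtain ⟨b, hb, hbe⟩ := intermediate_value_Icc hx0 hg.continuous_integral.continuousOn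
      (show ∫ y in (0)..x, f y ∈ Icc _ _ from ⟨by simpa using hf.integral_nonneg hx0, hlt.le⟩)
    rw [hcut x b hx0 hb.1 hbe.symm (hlt.trans_le (hg.integral_le_one hx0))]
    exact hg.antitone hb.2
  have h1 : ∫ x in c..a, g x ≤ ∫ x in c..a, f x :=
    intervalIntegral.integral_mono_on_of_le_Ioo hc.2 hg.antitone.intervalIntegrable
      hf.antitone.intervalIntegrable hle
  have h2 : ∫ y in (0)..c, g y ≤ ∫ y in (0)..c, f y := hcZ
  have h3 := intervalIntegral.integral_add_adjacent_intervals (a := 0) (b := c) (c := a)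
    (μ := volume) hf.antitone.intervalIntegrable hf.antitone.intervalIntegrable
  have h4 := intervalIntegral.integral_add_adjacent_intervals (a := 0) (b := c) (c := a)
    (μ := volume) hg.antitone.intervalIntegrable hg.antitone.intervalIntegrable
  linarith

theorem eq_of_cut (hf : IsProfile γ f) (hg : IsProfile γ g)
    (hcut : ∀ a b, 0 ≤ a → 0 ≤ b → ∫ x in (0)..a, f x = ∫ x in (0)..b, g x →
      ∫ x in (0)..a, f x < 1 → f a = g b) {a : ℝ} (ha : 0 ≤ a) : f a = g a := by
  have h1 := integral_le_integral hf hg hcut ha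
  have h2 := integral_le_integral hg hf
    (fun a b ha hb h h' => (hcut b a hb ha h.symm (h ▸ h')).symm) ha
  have heq := le_antisymm h2 h1
  rcases lt_or_ge (∫ x in (0)..a, f x) 1 with h | h
  · exact hcut a a ha ha heq h
  · have hf0 : f a = 0 := by
      by_contra h0
      exact h.not_gt (hf.integral_lt_one_of_pos ha ((hf.nonneg a).lt_of_ne' h0))
    have hg0 : g a = 0 := by
      by_contra h0
      exact (heq ▸ h).not_gt (hg.integral_lt_one_of_pos ha ((hg.nonneg a).lt_of_ne' h0))
    rw [hf0, hg0]

end IsProfile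

theorem rpow_mul_rpow_le_rootMean {n : ℕ} (hn : n ≠ 0) {t v w : ℝ} (ht0 : 0 < t) (ht1 : t < 1)
    (hv : 0 ≤ v) (hw : 0 ≤ w) : v ^ t * w ^ (1 - t) ≤ rootMean n t v w := by
  have hs : 0 < 1 - t := by linarith
  have h := Real.geom_mean_le_arith_mean2_weighted ht0.le hs.le (p₁ := v ^ (n : ℝ)⁻¹)
    (p₂ := w ^ (n : ℝ)⁻¹) (by positivity) (by positivity) (by ring)
  have hx : ∀ {x y : ℝ}, 0 ≤ x → ((x ^ (n : ℝ)⁻¹) ^ y) ^ n = x ^ y := by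
    intro x y hx
    rw [← Real.rpow_mul hx, mul_comm, Real.rpow_mul hx, Real.rpow_inv_natCast_pow (by positivity) hn]
  calc v ^ t * w ^ (1 - t) = ((v ^ (n : ℝ)⁻¹) ^ t * (w ^ (n : ℝ)⁻¹) ^ (1 - t)) ^ n := by
        rw [mul_pow, hx hv, hx hw]
    _ ≤ _ := by
        unfold rootMean
        gcongr

theorem rootMean_lt_rootMean {n : ℕ} (hn : n ≠ 0) {t v w v' w' : ℝ} (ht0 : 0 < t) (ht1 : t < 1)
    (hv : 0 ≤ v) (hw : 0 ≤ w) (hv' : v < v') (hw' : w ≤ w') :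
    rootMean n t v w < rootMean n t v' w' := by
  have hs : 0 < 1 - t := by linarith
  have h1 : v ^ (n : ℝ)⁻¹ < v' ^ (n : ℝ)⁻¹ := Real.rpow_lt_rpow hv hv' (by positivity)
  have h2 : w ^ (n : ℝ)⁻¹ ≤ w' ^ (n : ℝ)⁻¹ := by gcongr
  unfold rootMean
  exact pow_lt_pow_left₀ (add_lt_add_of_lt_of_le (by gcongr) (by gcongr)) (by positivity) hn

/-- `f`, `g`, `k` satisfy the inequality between the volumes of horizontal slices given by the
Brunn-Minkowski inequality in `ℝⁿ`. -/
def IsRootMeanBound (n : ℕ) (t : ℝ) (f g : ℝ → ℝ) (k : ℝ → ℝ≥0∞) : Prop :=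
  ∀ a b v w, 0 ≤ a → 0 ≤ b → 0 ≤ v → 0 ≤ w → v < f a → w < g b →
    ENNReal.ofReal (rootMean n t v w) ≤ k (t * a + (1 - t) * b)

namespace IsRootMeanBound

variable {n : ℕ} {t γ : ℝ} {f g : ℝ → ℝ} {k : ℝ → ℝ≥0∞}

theorem rpow_mul_rpow_le (H : IsRootMeanBound n t f g k) (hn : n ≠ 0) (ht0 : 0 < t) (ht1 : t < 1)
    {a b : ℝ} (ha : 0 ≤ a) (hb : 0 ≤ b) (hfa : 0 ≤ f a) (hgb : 0 ≤ g b) :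
    ENNReal.ofReal (f a) ^ t * ENNReal.ofReal (g b) ^ (1 - t) ≤ k (t * a + (1 - t) * b) := by
  have hs : 0 < 1 - t := by linarith
  rcases hfa.eq_or_lt with h0 | hfa'
  · simp [← h0, ht0]
  rcases hgb.eq_or_lt with h0 | hgb'
  · simp [← h0, hs]
  rw [ENNReal.ofReal_rpow_of_nonneg hfa ht0.le, ENNReal.ofReal_rpow_of_nonneg hgb hs.le,
    ← ENNReal.ofReal_mul (by positivity)]
  have hc : ∀ c : ℝ, c ∈ Ioo 0 1 →
      ENNReal.ofReal (c * (f a ^ t * g b ^ (1 - t))) ≤ k (t * a + (1 - t) * b) := by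
    intro c hc
    have h1 := H a b (c * f a) (c * g b) ha hb (by have := hc.1; positivity)
      (by have := hc.1; positivity) (by nlinarith [hc.2]) (by nlinarith [hc.2])
    refine le_trans (ENNReal.ofReal_le_ofReal (le_trans (le_of_eq ?_)
      (rpow_mul_rpow_le_rootMean hn ht0 ht1 (by have := hc.1; positivity)
        (by have := hc.1; positivity)))) h1
    rw [Real.mul_rpow hc.1.le hfa, Real.mul_rpow hc.1.le hgb]
    have : c ^ t * c ^ (1 - t) = c := by rw [← Real.rpow_add hc.1]; simp
    linear_combination (-(f a ^ t * g b ^ (1 - t))) * this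
  have hlim : Tendsto (fun c : ℝ => ENNReal.ofReal (c * (f a ^ t * g b ^ (1 - t))))
      (nhdsWithin 1 (Iio 1)) (nhds (ENNReal.ofReal (1 * (f a ^ t * g b ^ (1 - t))))) := by
    refine Tendsto.mono_left ?_ nhdsWithin_le_nhds
    exact (ENNReal.continuous_ofReal.comp (continuous_id.mul continuous_const)).tendsto 1
  rw [one_mul] at hlim
  refine le_of_tendsto hlim ?_
  filter_upwards [Ioo_mem_nhdsLT (zero_lt_one' ℝ)] with c hc' using hc c hc'

/-- The Prékopa–Leindler inequality for restrictions of `f` and `g` to sets on which they are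
maximal at `a` and `b` and have the same mass. -/
theorem piece (H : IsRootMeanBound n t f g k) (hn : n ≠ 0) (ht0 : 0 < t) (ht1 : t < 1)
    (hf : IsProfile γ f) (hg : IsProfile γ g) (hk : Measurable k) {S T U : Set ℝ}
    (hS : MeasurableSet S) (hT : MeasurableSet T) (hU : MeasurableSet U)
    (hS0 : ∀ x ∈ S, 0 ≤ x) (hT0 : ∀ x ∈ T, 0 ≤ x)
    (hSTU : ∀ x ∈ S, ∀ y ∈ T, t * x + (1 - t) * y ∈ U) {a b : ℝ}
    (ha : a ∈ S) (hb : b ∈ T) (hfa : 0 < f a) (hgb : 0 < g b) (hfS : ∀ x ∈ S, f x ≤ f a)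
    (hgT : ∀ x ∈ T, g x ≤ g b) {m : ℝ} (hm : 0 ≤ m)
    (hfm : ∫⁻ x in S, ENNReal.ofReal (f x) = ENNReal.ofReal m)
    (hgm : ∫⁻ x in T, ENNReal.ofReal (g x) = ENNReal.ofReal m) :
    ENNReal.ofReal (f a ^ t * g b ^ (1 - t) * (t / f a + (1 - t) / g b) * m) ≤ ∫⁻ x in U, k x := by
  have hs : 0 < 1 - t := by linarith
  have key := prekopa_leindler_strong (f := S.indicator fun x => ENNReal.ofReal (f x))
    (g := T.indicator fun x => ENNReal.ofReal (g x)) (h := U.indicator k)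
    (hf.measurable.indicator hS) (hg.measurable.indicator hT) (hk.indicator hU) ht0 ht1 hfa hgb
    (fun x => indicator_apply_le' (fun hx => ENNReal.ofReal_le_ofReal (hfS x hx)) fun _ => zero_le)
    (fun x => indicator_apply_le' (fun hx => ENNReal.ofReal_le_ofReal (hgT x hx)) fun _ => zero_le)
    (fun s hs => ⟨a, by
      rw [indicator_of_mem ha]; exact (ENNReal.ofReal_lt_ofReal_iff hfa).2 hs⟩)
    (fun s hs => ⟨b, by
      rw [indicator_of_mem hb]; exact (ENNReal.ofReal_lt_ofReal_iff hgb).2 hs⟩)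
    (fun x y => by
      by_cases hx : x ∈ S
      · by_cases hy : y ∈ T
        · rw [indicator_of_mem hx, indicator_of_mem hy, indicator_of_mem (hSTU x hx y hy)]
          exact H.rpow_mul_rpow_le hn ht0 ht1 (hS0 x hx) (hT0 y hy) (hf.nonneg x) (hg.nonneg y)
        · rw [indicator_of_notMem hy, ENNReal.zero_rpow_of_pos hs, mul_zero]
          exact zero_le
      · rw [indicator_of_notMem hx, ENNReal.zero_rpow_of_pos ht0, zero_mul]
        exact zero_le)
  rw [lintegral_indicator hS, lintegral_indicator hT, lintegral_indicator hU, hfm, hgm,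
    ← ENNReal.ofReal_mul (by positivity), ← ENNReal.ofReal_mul (by positivity),
    ← ENNReal.ofReal_add (by positivity) (by positivity), ← ENNReal.ofReal_mul (by positivity)]
    at key
  convert key using 2
  ring

theorem _root_.one_le_rpow_mul_rpow_mul {t α β : ℝ} (ht0 : 0 < t) (ht1 : t < 1) (hα : 0 < α)
    (hβ : 0 < β) : 1 ≤ α ^ t * β ^ (1 - t) * (t / α + (1 - t) / β) ∧
      (α ^ t * β ^ (1 - t) * (t / α + (1 - t) / β) ≤ 1 → α = β) := by
  have hs : 0 < 1 - t := by linarith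
  have e : 1 = α ^ t * β ^ (1 - t) * (α⁻¹ ^ t * β⁻¹ ^ (1 - t)) := by
    rw [Real.inv_rpow hα.le, Real.inv_rpow hβ.le]
    field_simp
  have e' : t / α + (1 - t) / β = t * α⁻¹ + (1 - t) * β⁻¹ := by ring
  rw [e']
  have h1 := Real.geom_mean_le_arith_mean2_weighted ht0.le hs.le (inv_pos.2 hα).le (inv_pos.2 hβ).le
    (by ring)
  refine ⟨?_, fun h => ?_⟩
  · calc 1 = _ := e
      _ ≤ _ := by gcongr
  · by_contra hne
    have h2 := (Real.geom_mean_lt_arith_mean2_weighted_iff_of_pos ht0 hs (inv_pos.2 hα).le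
      (inv_pos.2 hβ).le (by ring)).2 (fun h => hne (inv_injective h))
    have : α ^ t * β ^ (1 - t) * (α⁻¹ ^ t * β⁻¹ ^ (1 - t)) <
      α ^ t * β ^ (1 - t) * (t * α⁻¹ + (1 - t) * β⁻¹) := by gcongr
    linarith

theorem eq_of_integral_eq (H : IsRootMeanBound n t f g k) (hn : n ≠ 0) (ht0 : 0 < t) (ht1 : t < 1)
    (hf : IsProfile γ f) (hg : IsProfile γ g) (hk : Measurable k)
    (hk1 : ∫⁻ x in Ioi (0 : ℝ), k x ≤ 1) {a b : ℝ} (ha : 0 ≤ a) (hb : 0 ≤ b)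
    (hab : ∫ x in (0)..a, f x = ∫ x in (0)..b, g x) (hlt : ∫ x in (0)..a, f x < 1) :
    f a = g b := by
  have hs : 0 < 1 - t := by linarith
  have hfa := hf.pos_of_integral_lt_one ha hlt
  have hgb := hg.pos_of_integral_lt_one hb (hab ▸ hlt)
  have hf0 : 0 < f 0 := hfa.trans_le (hf.antitone ha)
  have hg0 : 0 < g 0 := hgb.trans_le (hg.antitone hb)
  set θ := ∫ x in (0)..a, f x with hθ
  have hθ0 : 0 ≤ θ := hf.integral_nonneg ha
  have hz : 0 ≤ t * a + (1 - t) * b := by positivity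
  have houter := H.piece hn ht0 ht1 hf hg hk (S := Ici a) (T := Ici b)
    (U := Ici (t * a + (1 - t) * b)) measurableSet_Ici measurableSet_Ici measurableSet_Ici
    (fun x hx => ha.trans hx) (fun x hx => hb.trans hx)
    (fun x (hx : a ≤ x) y (hy : b ≤ y) => mem_Ici.2 (by gcongr))
    self_mem_Ici self_mem_Ici hfa hgb (fun x hx => hf.antitone hx) (fun x hx => hg.antitone hx)
    (m := 1 - θ) (by linarith) (hf.lintegral_Ici ha) (by rw [hg.lintegral_Ici hb, ← hab])
  have hinner : ENNReal.ofReal θ ≤ ∫⁻ x in Ico 0 (t * a + (1 - t) * b), k x := by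
    rcases hθ0.eq_or_lt with h0 | h0
    · rw [← h0]; simp
    have ha0 : 0 < a := by
      refine ha.lt_of_ne fun h => ?_
      rw [hθ, ← h] at h0
      simp at h0
    have hb0 : 0 < b := by
      refine hb.lt_of_ne fun h => ?_
      rw [hab, ← h] at h0
      simp at h0
    have := H.piece hn ht0 ht1 hf hg hk (S := Ico 0 a) (T := Ico 0 b)
      (U := Ico 0 (t * a + (1 - t) * b)) measurableSet_Ico measurableSet_Ico measurableSet_Ico
      (fun x hx => hx.1) (fun x hx => hx.1)
      (fun x hx y hy => ⟨by have := hx.1; have := hy.1; positivity,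
        by have := hx.2; have := hy.2; gcongr⟩)
      (left_mem_Ico.2 ha0) (left_mem_Ico.2 hb0) hf0 hg0 (fun x hx => hf.antitone hx.1)
      (fun x hx => hg.antitone hx.1) hθ0 (hf.lintegral_Ico ha) (by rw [hg.lintegral_Ico hb, ← hab])
    refine le_trans (ENNReal.ofReal_le_ofReal ?_) this
    exact le_mul_of_one_le_left hθ0 (one_le_rpow_mul_rpow_mul ht0 ht1 hf0 hg0).1
  have hsum := (add_le_add hinner houter).trans
    ((IsProfile.lintegral_Ico_add_Ici k hz).le.trans hk1)
  have hC := one_le_rpow_mul_rpow_mul ht0 ht1 hfa hgb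
  apply hC.2
  have hC0 : 0 ≤ f a ^ t * g b ^ (1 - t) * (t / f a + (1 - t) / g b) := zero_le_one.trans hC.1
  rw [← ENNReal.ofReal_add hθ0 (mul_nonneg hC0 (by linarith)), ← ENNReal.ofReal_one,
    ENNReal.ofReal_le_ofReal_iff zero_le_one] at hsum
  have h1θ : 0 < 1 - θ := by linarith
  by_contra h
  nlinarith [not_le.1 h]

theorem profile_eq (H : IsRootMeanBound n t f g k) (hn : n ≠ 0) (ht0 : 0 < t) (ht1 : t < 1)
    (hf : IsProfile γ f) (hg : IsProfile γ g) (hk : Measurable k)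
    (hk1 : ∫⁻ x in Ioi (0 : ℝ), k x ≤ 1) {a : ℝ} (ha : 0 ≤ a) : f a = g a :=
  hf.eq_of_cut hg (fun _ _ ha hb hab hlt =>
    H.eq_of_integral_eq hn ht0 ht1 hf hg hk hk1 ha hb hab hlt) ha

theorem rootMean_lt (H : IsRootMeanBound n t f g k) (hn : n ≠ 0) (ht0 : 0 < t) (ht1 : t < 1)
    (hf : IsProfile γ f) (hg : IsProfile γ g) (hk : Measurable k)
    (hk1 : ∫⁻ x in Ioi (0 : ℝ), k x ≤ 1) {a b v w : ℝ} (ha : 0 ≤ a) (hb : 0 ≤ b) (hv : 0 ≤ v)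
    (hw : 0 ≤ w) (hva : v < f a) (hwb : w < f b) :
    rootMean n t v w < f (t * a + (1 - t) * b) := by
  have hs : 0 < 1 - t := by linarith
  have hfg : ∀ {x}, 0 ≤ x → f x = g x := fun hx => H.profile_eq hn ht0 ht1 hf hg hk hk1 hx
  have hle : (fun x => ENNReal.ofReal (f x)) ≤ᵐ[volume.restrict (Ioi 0)] k := by
    refine (ae_restrict_mem measurableSet_Ioi).mono fun x hx => ?_
    have hx0 : 0 ≤ x := (mem_Ioi.1 hx).le
    have h := H.rpow_mul_rpow_le hn ht0 ht1 hx0 hx0 (hf.nonneg x) (hg.nonneg x)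
    rw [← hfg hx0, ← ENNReal.rpow_add_of_nonneg _ _ ht0.le hs.le] at h
    have e : t * x + (1 - t) * x = x := by ring
    simpa [e] using h
  have hae := ae_eq_of_ae_le_of_lintegral_le hle (by rw [hf.lintegral_eq_one]; simp)
    hk.aemeasurable (by rw [hf.lintegral_eq_one]; exact hk1)
  obtain ⟨v', hvv', hv'⟩ := exists_between hva
  obtain ⟨a', ha', hva'⟩ := hf.exists_gt a v' hv'
  obtain ⟨b', hb', hwb'⟩ := hf.exists_gt b w hwb
  refine (rootMean_lt_rootMean hn ht0 ht1 hv hw hvv' le_rfl).trans_le ?_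
  rw [Filter.EventuallyEq, ae_restrict_iff' measurableSet_Ioi] at hae
  obtain ⟨l, hl, hlk⟩ : ∃ l ∈ Ioo (0 : ℝ) 1,
      ENNReal.ofReal (f (t * a + (1 - t) * b + l * (t * (a' - a) + (1 - t) * (b' - b)))) =
        k (t * a + (1 - t) * b + l * (t * (a' - a) + (1 - t) * (b' - b))) := by
    have hd : 0 < t * (a' - a) + (1 - t) * (b' - b) := by
      have := sub_pos.2 ha'; have := sub_pos.2 hb'; positivity
    set z := t * a + (1 - t) * b with hz
    have hz0 : 0 ≤ z := by positivity
    set d := t * (a' - a) + (1 - t) * (b' - b)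
    obtain ⟨y, hy, hyk⟩ := (Measure.dense_of_ae hae).exists_mem_open isOpen_Ioo
      (nonempty_Ioo.2 (show z < z + d by linarith))
    refine ⟨(y - z) / d, ⟨div_pos (by linarith [hyk.1]) hd,
      (div_lt_one hd).2 (by linarith [hyk.2])⟩, ?_⟩
    have e : z + (y - z) / d * d = y := by field_simp; ring
    rw [e]
    exact hy (hz0.trans_lt hyk.1)
  set x := a + l * (a' - a) with hx
  set y := b + l * (b' - b) with hy
  have hexy : t * a + (1 - t) * b + l * (t * (a' - a) + (1 - t) * (b' - b)) =
    t * x + (1 - t) * y := by rw [hx, hy]; ring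
  rw [hexy] at hlk
  have hax : a ≤ x := by nlinarith [hl.1, sub_pos.2 ha']
  have hby : b ≤ y := by nlinarith [hl.1, sub_pos.2 hb']
  have hxa : x ≤ a' := by nlinarith [hl.2, sub_pos.2 ha']
  have hyb : y ≤ b' := by nlinarith [hl.2, sub_pos.2 hb']
  have h1 := H x y v' w (ha.trans hax) (hb.trans hby) (hv.trans hvv'.le) hw
    (hva'.trans_le (hf.antitone hxa))
    (by rw [← hfg (hb.trans hby)]; exact hwb'.trans_le (hf.antitone hyb))
  rw [← hlk, ENNReal.ofReal_le_ofReal_iff (hf.nonneg _)] at h1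
  exact h1.trans (hf.antitone (by gcongr))

end IsRootMeanBound

/-- The open ball in `ℝⁿ` centered at `0` with measure `v`. -/
def centeredBall (n : ℕ) (v : ℝ≥0∞) : Set (Edim n) :=
  {x | volume (Metric.ball (0 : Edim n) ‖x‖) < v}

theorem volume_ball_edim {n : ℕ} (hn : n ≠ 0) {r : ℝ} (hr : 0 ≤ r) :
    volume (Metric.ball (0 : Edim n) r) =
      ENNReal.ofReal (volume (Metric.ball (0 : Edim n) 1)).toReal * ENNReal.ofReal (r ^ n) := by
  have : NeZero n := ⟨hn⟩
  rw [Measure.addHaar_ball volume (0 : Edim n) hr, finrank_euclideanSpace_fin, mul_comm,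
    ENNReal.ofReal_toReal Metric.isBounded_ball.measure_lt_top.ne]

theorem volume_unitBall_pos (n : ℕ) : 0 < (volume (Metric.ball (0 : Edim n) 1)).toReal :=
  ENNReal.toReal_pos (Metric.measure_ball_pos _ _ zero_lt_one).ne'
    Metric.isBounded_ball.measure_lt_top.ne

theorem mem_centeredBall_ofReal {n : ℕ} (hn : n ≠ 0) {v : ℝ} {x : Edim n} :
    x ∈ centeredBall n (ENNReal.ofReal v) ↔
      (volume (Metric.ball (0 : Edim n) 1)).toReal * ‖x‖ ^ n < v := by
  have := volume_unitBall_pos n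
  rw [centeredBall, mem_ofPred_eq, volume_ball_edim hn (norm_nonneg x),
    ← ENNReal.ofReal_mul (by positivity), ENNReal.ofReal_lt_ofReal_iff_of_nonneg (by positivity)]

theorem centeredBall_mono {n : ℕ} {v w : ℝ≥0∞} (h : v ≤ w) : centeredBall n v ⊆ centeredBall n w :=
  fun _ hx => lt_of_lt_of_le hx h

theorem volume_centeredBall {n : ℕ} (hn : n ≠ 0) {v : ℝ≥0∞} (hv : v ≠ ⊤) :
    volume (centeredBall n v) = v := by
  set ω := (volume (Metric.ball (0 : Edim n) 1)).toReal with hω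
  have hω0 : 0 < ω := volume_unitBall_pos n
  set r := (v.toReal / ω) ^ (n : ℝ)⁻¹
  have hr : r ^ n = v.toReal / ω := Real.rpow_inv_natCast_pow (by positivity) hn
  have e : centeredBall n v = Metric.ball 0 r := by
    ext x
    rw [← ENNReal.ofReal_toReal hv, mem_centeredBall_ofReal hn, mem_ball_zero_iff, ← hω,
      ← pow_lt_pow_iff_left₀ (norm_nonneg x) (by positivity) hn, hr, lt_div_iff₀' hω0]
  rw [e, volume_ball_edim hn (by positivity), hr, ← hω, ← ENNReal.ofReal_mul hω0.le,
    mul_div_cancel₀ _ hω0.ne', ENNReal.ofReal_toReal hv]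

theorem measurable_volume_ball_norm {n : ℕ} (hn : n ≠ 0) :
    Measurable fun x : Edim n => volume (Metric.ball (0 : Edim n) ‖x‖) := by
  simp_rw [volume_ball_edim hn (norm_nonneg _)]
  fun_prop

theorem measurableSet_centeredBall {n : ℕ} (hn : n ≠ 0) (v : ℝ≥0∞) :
    MeasurableSet (centeredBall n v) :=
  measurableSet_lt (measurable_volume_ball_norm hn) measurable_const

theorem volume_le_add_volume_symmDiff {X : Type*} [MeasureSpace X] (P Q : Set X) :
    volume P ≤ volume Q + volume (symmDiff P Q) := by
  refine (measure_mono fun x hx => ?_).trans (measure_union_le _ _)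
  by_cases h : x ∈ Q
  · exact Or.inl h
  · exact Or.inr (Or.inl ⟨hx, h⟩)

theorem volume_symmDiff_centeredBall_le {n : ℕ} (hn : n ≠ 0) {v w : ℝ≥0∞} (hv : v ≠ ⊤)
    (hw : w ≠ ⊤) :
    volume (symmDiff (centeredBall n v) (centeredBall n w)) ≤ (v - w) + (w - v) := by
  rw [Set.symmDiff_def]
  refine (measure_union_le _ _).trans (le_of_eq ?_)
  have key : ∀ {v w : ℝ≥0∞}, v ≠ ⊤ → w ≠ ⊤ →
      volume (centeredBall n v \ centeredBall n w) = v - w := by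
    intro v w hv hw
    rcases le_total v w with h | h
    · rw [sdiff_eq_empty.2 (centeredBall_mono h), measure_empty, tsub_eq_zero_of_le h]
    · rw [measure_sdiff (centeredBall_mono h) (measurableSet_centeredBall hn w).nullMeasurableSet
        (by rwa [volume_centeredBall hn hw]), volume_centeredBall hn hv, volume_centeredBall hn hw]
  rw [key hv hw, key hw hv]

/-- The measure of the set of `x` for which the slice of `A` over `x` is longer than `s`. -/
def levelVolume {n : ℕ} (A : Set (Sp n)) (s : ℝ) : ℝ≥0∞ :=
  volume {x : Edim n | ENNReal.ofReal s < volume (vslice A x)}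

theorem antitone_levelVolume {n : ℕ} (A : Set (Sp n)) : Antitone (levelVolume A) :=
  fun _ _ h => measure_mono fun _ hx => (ENNReal.ofReal_le_ofReal h).trans_lt hx

theorem measurable_levelVolume {n : ℕ} (A : Set (Sp n)) : Measurable (levelVolume A) :=
  (antitone_levelVolume A).measurable

theorem measurable_volume_vslice {n : ℕ} {A : Set (Sp n)} (hA : MeasurableSet A) :
    Measurable fun x => volume (vslice A x) :=
  measurable_measure_prodMk_left hA

theorem lintegral_levelVolume {n : ℕ} {A : Set (Sp n)} (hA : MeasurableSet A) :
    ∫⁻ s in Ioi (0 : ℝ), levelVolume A s = volume A := by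
  unfold levelVolume
  rw [lintegral_meas_ofReal_lt volume (measurable_volume_vslice hA), Measure.volume_eq_prod,
    Measure.prod_apply hA]
  rfl

theorem IsNormalized.levelVolume_le {n : ℕ} {γ : ℝ} {A : Set (Sp n)} (hA : IsNormalized γ A)
    (s : ℝ) : levelVolume A s ≤ ENNReal.ofReal γ := by
  refine (measure_mono fun x hx => ?_).trans hA.2.2
  obtain ⟨y, hy⟩ := nonempty_of_measure_ne_zero (zero_le.trans_lt hx).ne'
  exact ⟨(x, y), hy, rfl⟩

theorem IsNormalized.levelVolume_eq_zero {n : ℕ} {γ : ℝ} {A : Set (Sp n)} (hA : IsNormalized γ A)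
    {s : ℝ} (hs : γ ≤ s) : levelVolume A s = 0 := by
  rw [levelVolume, ← measure_empty (μ := (volume : Measure (Edim n)))]
  congr 1
  refine eq_empty_of_forall_notMem fun x hx => (lt_irrefl (ENNReal.ofReal s)) ?_
  exact lt_of_lt_of_le hx ((le_iSup (fun x => volume (vslice A x)) x).trans
    (hA.2.1.trans (ENNReal.ofReal_le_ofReal hs)))

/-- The set whose horizontal slice at height `y` is the centered ball of measure `h (2 |y|)`. -/
def ballStack (n : ℕ) (h : ℝ → ℝ≥0∞) : Set (Sp n) :=
  {p | volume (Metric.ball (0 : Edim n) ‖p.1‖) < h (2 * |p.2|)}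

theorem hslice_ballStack {n : ℕ} (h : ℝ → ℝ≥0∞) (y : ℝ) :
    hslice (ballStack n h) y = centeredBall n (h (2 * |y|)) := rfl

theorem natSymm_eq_ballStack {n : ℕ} (A : Set (Sp n)) :
    natSymm A = ballStack n (levelVolume A) := rfl

theorem measurableSet_ballStack {n : ℕ} (hn : n ≠ 0) {h : ℝ → ℝ≥0∞} (hh : Measurable h) :
    MeasurableSet (ballStack n h) :=
  measurableSet_lt ((measurable_volume_ball_norm hn).comp measurable_fst)
    (hh.comp (by fun_prop))

theorem measurableSet_natSymm {n : ℕ} (hn : n ≠ 0) (A : Set (Sp n)) : MeasurableSet (natSymm A) :=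
  measurableSet_ballStack hn (measurable_levelVolume A)

theorem volume_symmDiff_eq_lintegral {n : ℕ} {A B : Set (Sp n)} (hA : MeasurableSet A)
    (hB : MeasurableSet B) :
    volume (symmDiff A B) = ∫⁻ y : ℝ, volume (symmDiff (hslice A y) (hslice B y)) := by
  rw [Measure.volume_eq_prod, Measure.prod_apply_symm (hA.symmDiff hB)]
  rfl

theorem measurable_volume_symmDiff_hslice {n : ℕ} {A B : Set (Sp n)} (hA : MeasurableSet A)
    (hB : MeasurableSet B) :
    Measurable fun y : ℝ => volume (symmDiff (hslice A y) (hslice B y)) :=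
  measurable_measure_prodMk_right (hA.symmDiff hB)

namespace IsProfile

variable {γ : ℝ} {f : ℝ → ℝ} {n : ℕ}

theorem levelVolume_ballStack (hf : IsProfile γ f) (hn : n ≠ 0) {s : ℝ} (hs : 0 ≤ s) :
    levelVolume (ballStack n fun s => ENNReal.ofReal (f s)) s = ENNReal.ofReal (f s) := by
  rw [← volume_centeredBall hn ENNReal.ofReal_ne_top, levelVolume]
  congr 1
  ext x
  constructor
  · intro hx
    by_contra hlt
    refine (mem_ofPred_eq.mp hx).not_ge ?_
    have hsub : vslice (ballStack n fun s => ENNReal.ofReal (f s)) x ⊆ Ioo (-(s / 2)) (s / 2) := by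
      intro y hy
      have h1 : ¬ s ≤ 2 * |y| := fun h => hlt
        (lt_of_lt_of_le hy (ENNReal.ofReal_le_ofReal (hf.antitone h)))
      exact abs_lt.1 (by linarith)
    refine (measure_mono hsub).trans ?_
    rw [Real.volume_Ioo]
    exact ENNReal.ofReal_le_ofReal (by linarith)
  · intro hx
    rw [mem_centeredBall_ofReal hn] at hx
    obtain ⟨s', hs', hx'⟩ := hf.exists_gt _ _ hx
    have hsub : Icc (-(s' / 2)) (s' / 2) ⊆
        vslice (ballStack n fun s => ENNReal.ofReal (f s)) x := by
      intro y hy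
      exact (mem_centeredBall_ofReal hn).2 (hx'.trans_le (hf.antitone
        (by have := abs_le.2 hy; linarith)))
    refine lt_of_lt_of_le ?_ (measure_mono hsub)
    rw [Real.volume_Icc, ENNReal.ofReal_lt_ofReal_iff_of_nonneg hs]
    linarith

theorem natSymm_ballStack (hf : IsProfile γ f) (hn : n ≠ 0) :
    natSymm (ballStack n fun s => ENNReal.ofReal (f s)) =
      ballStack n fun s => ENNReal.ofReal (f s) := by
  ext p
  rw [natSymm_eq_ballStack, ballStack, mem_ofPred_eq, hf.levelVolume_ballStack hn (by positivity)]
  rfl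

theorem volume_ballStack (hf : IsProfile γ f) (hn : n ≠ 0) :
    volume (ballStack n fun s => ENNReal.ofReal (f s)) = 1 := by
  rw [← lintegral_levelVolume (measurableSet_ballStack hn hf.measurable), ← hf.lintegral_eq_one]
  exact setLIntegral_congr_fun measurableSet_Ioi fun s hs =>
    hf.levelVolume_ballStack hn (mem_Ioi.1 hs).le

theorem isNormalized_ballStack (hf : IsProfile γ f) (hn : n ≠ 0) (hγ : 1 ≤ γ) :
    IsNormalized γ (ballStack n fun s => ENNReal.ofReal (f s)) := by
  refine ⟨?_, iSup_le fun x => ?_, ?_⟩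
  · rw [hf.volume_ballStack hn, ← ENNReal.ofReal_one]
    exact ENNReal.ofReal_le_ofReal (inv_le_one_of_one_le₀ hγ)
  · have hsub : vslice (ballStack n fun s => ENNReal.ofReal (f s)) x ⊆ Ioo (-(γ / 2)) (γ / 2) := by
      intro y hy
      have h1 : ¬ γ ≤ 2 * |y| := by
        intro h
        have : volume (Metric.ball (0 : Edim n) ‖x‖) < ENNReal.ofReal (f (2 * |y|)) := hy
        rw [hf.eq_zero _ h, ENNReal.ofReal_zero] at this
        exact absurd this _root_.not_lt_zero
      exact abs_lt.1 (by linarith)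
    refine (measure_mono hsub).trans ?_
    rw [Real.volume_Ioo]
    exact ENNReal.ofReal_le_ofReal (by linarith)
  · have hsub : Prod.fst '' (ballStack n fun s => ENNReal.ofReal (f s)) ⊆
        centeredBall n (ENNReal.ofReal (f 0)) := by
      rintro _ ⟨p, hp, rfl⟩
      exact lt_of_lt_of_le hp (ENNReal.ofReal_le_ofReal (hf.antitone (by positivity)))
    refine (measure_mono hsub).trans ?_
    rw [volume_centeredBall hn ENNReal.ofReal_ne_top]
    exact ENNReal.ofReal_le_ofReal (hf.le 0)

theorem mem_ballStack_iff (hn : n ≠ 0) {p : Sp n} :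
    p ∈ ballStack n (fun s => ENNReal.ofReal (f s)) ↔
      (volume (Metric.ball (0 : Edim n) 1)).toReal * ‖p.1‖ ^ n < f (2 * |p.2|) :=
  mem_centeredBall_ofReal hn

theorem isOpen_ballStack (hf : IsProfile γ f) (hn : n ≠ 0) :
    IsOpen (ballStack n fun s => ENNReal.ofReal (f s)) := by
  rw [isOpen_iff_mem_nhds]
  intro p hp
  rw [mem_ballStack_iff hn] at hp
  obtain ⟨s, hs, hps⟩ := hf.exists_gt _ _ hp
  have h1 : ∀ᶠ q : Sp n in nhds p,
      (volume (Metric.ball (0 : Edim n) 1)).toReal * ‖q.1‖ ^ n < f s :=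
    ContinuousAt.eventually_lt (by fun_prop) continuousAt_const hps
  have h2 : ∀ᶠ q : Sp n in nhds p, 2 * |q.2| < s :=
    ContinuousAt.eventually_lt (by fun_prop) continuousAt_const hs
  filter_upwards [h1, h2] with q hq1 hq2
  exact (mem_ballStack_iff hn).2 (hq1.trans_le (hf.antitone hq2.le))

end IsProfile

/-- A closed set which is stable under a single nontrivial convex combination is convex. -/
theorem IsClosed.convex_of_combo_mem {E : Type*} [NormedAddCommGroup E] [NormedSpace ℝ E]
    {K : Set E} (hK : IsClosed K) {t : ℝ} (ht0 : 0 < t) (ht1 : t < 1)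
    (h : ∀ p ∈ K, ∀ q ∈ K, t • p + (1 - t) • q ∈ K) : Convex ℝ K := by
  rw [convex_iff_segment_subset]
  intro p hp q hq
  set L : ℝ → E := fun s => p + s • (q - p) with hL
  have hLc : Continuous L := by fun_prop
  have hcl : IsClosed (L ⁻¹' K ∩ Icc 0 1) := (hK.preimage hLc).inter isClosed_Icc
  have hcombo : ∀ a b : ℝ, L a ∈ K → L b ∈ K → L (t * a + (1 - t) * b) ∈ K := by
    intro a b ha hb
    convert h _ ha _ hb using 1
    simp only [hL]
    module
  have hsub : Icc (0 : ℝ) 1 ⊆ L ⁻¹' K := by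
    refine hcl.Icc_subset_of_forall_exists_gt (by simpa [hL] using hp) ?_
    rintro x ⟨hxK, hx0, hx1⟩ y hy
    have hpow : ∀ k : ℕ, L (x + (1 - t) ^ k * (1 - x)) ∈ K := by
      intro k
      induction k with
      | zero => simpa [hL] using hq
      | succ k ih =>
        convert hcombo x _ hxK ih using 2
        ring
    have hlim : Tendsto (fun k : ℕ => x + (1 - t) ^ k * (1 - x)) atTop (nhds x) := by
      have := ((tendsto_pow_atTop_nhds_zero_of_lt_one (r := 1 - t) (by linarith)
        (by linarith)).mul_const (1 - x)).const_add x
      simpa using this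
    obtain ⟨k, hk⟩ := (hlim.eventually (Iio_mem_nhds (mem_Ioi.1 hy))).exists
    refine ⟨_, hpow k, ?_, hk.le⟩
    have : 0 < (1 - t) ^ k * (1 - x) := mul_pos (pow_pos (by linarith) k) (by linarith)
    linarith
  rw [segment_eq_image']
  rintro _ ⟨s, hs, rfl⟩
  exact hsub hs

/-- An open set which is stable under a single nontrivial convex combination is convex. -/
theorem IsOpen.convex_of_combo_mem {E : Type*} [NormedAddCommGroup E] [NormedSpace ℝ E]
    {U : Set E} (hU : IsOpen U) {t : ℝ} (ht0 : 0 < t) (ht1 : t < 1)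
    (h : ∀ p ∈ U, ∀ q ∈ U, t • p + (1 - t) • q ∈ U) : Convex ℝ U := by
  have hs : 0 < 1 - t := by linarith
  have hcl : Convex ℝ (closure U) := isClosed_closure.convex_of_combo_mem ht0 ht1
    fun p hp q hq => map_mem_closure₂ (f := fun p q => t • p + (1 - t) • q) (by fun_prop) hp hq h
  have hUi : U ⊆ interior (closure U) := interior_maximal subset_closure hU
  suffices interior (closure U) ⊆ U by
    rw [hUi.antisymm this]
    exact hcl.interior
  intro z hz
  -- points of `U` near `z`, whose reflection `q ↦ (z - (1 - t) q) / t` is also in `U`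
  set R : E → E := fun q => t⁻¹ • (z - (1 - t) • q) with hR
  have hRc : Continuous R := by fun_prop
  have hRz : R z = z := by
    simp only [hR]
    rw [show z - (1 - t) • z = t • z by module, inv_smul_smul₀ ht0.ne']
  have hV : interior (closure U) ∩ R ⁻¹' interior (closure U) ∈ nhds z :=
    (isOpen_interior.inter (isOpen_interior.preimage hRc)).mem_nhds ⟨hz, by rwa [mem_preimage, hRz]⟩
  obtain ⟨q₀, hq₀, hq₀U⟩ := mem_closure_iff_nhds.1 (interior_subset hz) _ hV
  have hRq : R q₀ ∈ closure U := interior_subset hq₀.2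
  set S : E → E := fun p => (1 - t)⁻¹ • (z - t • p) with hS
  have hSc : Continuous S := by fun_prop
  have hSR : S (R q₀) = q₀ := by
    simp only [hR, hS]
    rw [smul_inv_smul₀ ht0.ne', _root_.sub_sub_cancel, inv_smul_smul₀ hs.ne']
  obtain ⟨p, hpS, hpU⟩ := mem_closure_iff_nhds.1 hRq (S ⁻¹' U)
    ((hU.preimage hSc).mem_nhds (by rwa [mem_preimage, hSR]))
  have := h p hpU _ hpS
  rwa [show t • p + (1 - t) • S p = z by
    simp only [hS]
    rw [smul_inv_smul₀ hs.ne', add_sub_cancel]] at this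

theorem IsProfile.convex_ballStack {n : ℕ} {γ t : ℝ} {f : ℝ → ℝ} (hf : IsProfile γ f) (hn : n ≠ 0)
    (ht0 : 0 < t) (ht1 : t < 1)
    (h : ∀ a b v w, 0 ≤ a → 0 ≤ b → 0 ≤ v → 0 ≤ w → v < f a → w < f b →
      rootMean n t v w < f (t * a + (1 - t) * b)) :
    Convex ℝ (ballStack n fun s => ENNReal.ofReal (f s)) := by
  have hs : 0 < 1 - t := by linarith
  refine (hf.isOpen_ballStack hn).convex_of_combo_mem ht0 ht1 fun p hp q hq => ?_
  rw [IsProfile.mem_ballStack_iff hn] at hp hq ⊢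
  set ω := (volume (Metric.ball (0 : Edim n) 1)).toReal
  have hω : 0 < ω := volume_unitBall_pos n
  have key := h _ _ _ _ (by positivity) (by positivity) (by positivity) (by positivity) hp hq
  have hroot : ∀ r : ℝ, 0 ≤ r → (ω * r ^ n) ^ (n : ℝ)⁻¹ = ω ^ (n : ℝ)⁻¹ * r := by
    intro r hr
    rw [Real.mul_rpow hω.le (by positivity), Real.pow_rpow_inv_natCast hr hn]
  have hmean : rootMean n t (ω * ‖p.1‖ ^ n) (ω * ‖q.1‖ ^ n) =
      ω * (t * ‖p.1‖ + (1 - t) * ‖q.1‖) ^ n := by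
    rw [rootMean, hroot _ (norm_nonneg _), hroot _ (norm_nonneg _),
      show t * (ω ^ (n : ℝ)⁻¹ * ‖p.1‖) + (1 - t) * (ω ^ (n : ℝ)⁻¹ * ‖q.1‖) =
        ω ^ (n : ℝ)⁻¹ * (t * ‖p.1‖ + (1 - t) * ‖q.1‖) by ring, mul_pow,
      Real.rpow_inv_natCast_pow hω.le hn]
  rw [hmean] at key
  have hnorm : ‖(t • p + (1 - t) • q).1‖ ≤ t * ‖p.1‖ + (1 - t) * ‖q.1‖ := by
    refine (norm_add_le _ _).trans (le_of_eq ?_)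
    rw [Prod.smul_fst, Prod.smul_fst, norm_smul, norm_smul, Real.norm_of_nonneg ht0.le,
      Real.norm_of_nonneg hs.le]
  have habs : |(t • p + (1 - t) • q).2| ≤ t * |p.2| + (1 - t) * |q.2| := by
    refine (abs_add_le _ _).trans (le_of_eq ?_)
    rw [Prod.smul_snd, Prod.smul_snd, smul_eq_mul, smul_eq_mul, abs_mul, abs_mul,
      abs_of_pos ht0, abs_of_pos hs]
  calc ω * ‖(t • p + (1 - t) • q).1‖ ^ n ≤ ω * (t * ‖p.1‖ + (1 - t) * ‖q.1‖) ^ n := by gcongr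
    _ < _ := key
    _ ≤ _ := hf.antitone (by linarith)

theorem exists_seq_tendsto_ae_of_tendsto_lintegral {X : Type*} [MeasurableSpace X] {μ : Measure X}
    {u : ℕ → X → ℝ≥0∞} (hu : ∀ k, Measurable (u k))
    (h : Tendsto (fun k => ∫⁻ x, u k x ∂μ) atTop (nhds 0)) :
    ∃ ns : ℕ → ℕ, StrictMono ns ∧ ∀ᵐ x ∂μ, Tendsto (fun k => u (ns k) x) atTop (nhds 0) := by
  obtain ⟨ns, hns, hlt⟩ := extraction_forall_of_eventually (fun k : ℕ =>
    h.eventually (Iio_mem_nhds (show (0 : ℝ≥0∞) < (1 / 2) ^ k from ENNReal.pow_pos (by simp) k)))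
  refine ⟨ns, hns, ?_⟩
  have hfin : ∫⁻ x, ∑' k, u (ns k) x ∂μ ≠ ⊤ := by
    rw [lintegral_tsum fun k => (hu _).aemeasurable]
    refine ne_top_of_le_ne_top ?_ (ENNReal.tsum_le_tsum fun k => (hlt k).le)
    rw [ENNReal.tsum_geometric]
    simp
  filter_upwards [ae_lt_top (Measurable.tsum fun k => hu _) hfin] with x hx
  exact ENNReal.tendsto_atTop_zero_of_tsum_ne_top hx.ne

theorem exists_tendsto_measure_symmDiff_of_tendsto_Lp {X : Type*} [MeasurableSpace X]
    {μ : Measure X} {p : ℝ≥0∞} [Fact (1 ≤ p)] {A : ℕ → Set X} {u : ℕ → Lp ℝ p μ} {w : Lp ℝ p μ}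
    (hA : ∀ k, (u k : X → ℝ) =ᵐ[μ] (A k).indicator 1) (h : Tendsto u atTop (nhds w)) :
    ∃ E : Set X, MeasurableSet E ∧ Tendsto (fun k => μ (symmDiff (A k) E)) atTop (nhds 0) := by
  have hm := tendstoInMeasure_of_tendsto_Lp h (ENNReal.ofReal (1 / 2)) (by simp)
  refine ⟨{x | 1 / 2 < w x}, measurableSet_lt measurable_const (Lp.stronglyMeasurable w).measurable,
    tendsto_of_tendsto_of_tendsto_of_le_of_le tendsto_const_nhds hm (fun _ => zero_le)
      fun k => measure_mono_ae ?_⟩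
  filter_upwards [hA k] with x hx hmem
  change ENNReal.ofReal (1 / 2) ≤ edist (u k x) (w x)
  rw [edist_dist, hx]
  refine ENNReal.ofReal_le_ofReal ?_
  rw [Real.dist_eq]
  rcases hmem with ⟨h1, h2⟩ | ⟨h1, h2⟩
  · have h2 : w x ≤ 1 / 2 := not_lt.1 h2
    rw [indicator_of_mem h1, Pi.one_apply]
    exact le_trans (by linarith) (le_abs_self _)
  · have h1 : 1 / 2 < w x := h1
    rw [indicator_of_notMem h2, zero_sub, abs_neg]
    exact h1.le.trans (le_abs_self _)

theorem ae_comp_mul_left {P : ℝ → Prop} (h : ∀ᵐ s, P s) {c : ℝ} (hc : c ≠ 0) :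
    ∀ᵐ y, P (c * y) := by
  have := Real.volume_preimage_mul_left hc {s | ¬ P s}
  rw [ae_iff.1 h, mul_zero] at this
  exact this

theorem ae_two_mul_abs {P : ℝ → Prop} (h : ∀ᵐ s, P s) : ∀ᵐ y : ℝ, P (2 * |y|) := by
  filter_upwards [ae_comp_mul_left h (c := 2) (by norm_num),
    ae_comp_mul_left h (c := -2) (by norm_num)] with y h1 h2
  rcases abs_choice y with hy | hy <;> rw [hy]
  · exact h1
  · rwa [mul_neg, ← neg_mul]

theorem ae_restrict_Ioi_of_ae_two_mul_abs {P : ℝ → Prop} (h : ∀ᵐ y : ℝ, P (2 * |y|)) :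
    ∀ᵐ s ∂volume.restrict (Ioi (0 : ℝ)), P s := by
  filter_upwards [ae_restrict_mem measurableSet_Ioi,
    ae_restrict_of_ae (ae_comp_mul_left h (c := 1 / 2) (by norm_num))] with s hs h1
  rwa [abs_of_pos (by have := mem_Ioi.1 hs; positivity),
    show 2 * (1 / 2 * s) = s by ring] at h1

theorem tendsto_measure_of_tendsto_symmDiff {X : Type*} [MeasureSpace X] {P : ℕ → Set X} {Q : Set X}
    (hQ : volume Q ≠ ⊤) (h : Tendsto (fun k => volume (symmDiff (P k) Q)) atTop (nhds 0)) :
    Tendsto (fun k => volume (P k)) atTop (nhds (volume Q)) := by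
  have h1 := ENNReal.Tendsto.sub (tendsto_const_nhds (x := volume Q)) h (Or.inl hQ)
  have h2 := (tendsto_const_nhds (x := volume Q)).add h
  rw [tsub_zero] at h1
  rw [add_zero] at h2
  refine tendsto_of_tendsto_of_tendsto_of_le_of_le h1 h2 (fun k => ?_)
    (fun k => volume_le_add_volume_symmDiff _ _)
  rw [tsub_le_iff_right, symmDiff_comm]
  exact volume_le_add_volume_symmDiff _ _

theorem tendsto_sub_add_sub {v : ℕ → ℝ≥0∞} {w : ℝ≥0∞} (hw : w ≠ ⊤)
    (h : Tendsto v atTop (nhds w)) :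
    Tendsto (fun k => (v k - w) + (w - v k)) atTop (nhds 0) := by
  have h1 := (ENNReal.Tendsto.sub h (tendsto_const_nhds (x := w)) (Or.inl hw)).add
    (ENNReal.Tendsto.sub (tendsto_const_nhds (x := w)) h (Or.inl hw))
  simpa using h1

theorem volume_symmDiff_triangle {X : Type*} [MeasureSpace X] (P Q R : Set X) :
    volume (symmDiff P R) ≤ volume (symmDiff P Q) + volume (symmDiff Q R) :=
  measure_symmDiff_le P Q R

/-- The right-continuous modification of an antitone function. -/
theorem exists_rightContinuous {G : ℝ → ℝ≥0∞} (hG : Antitone G) {γ : ℝ}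
    (hle : ∀ s, G s ≤ ENNReal.ofReal γ) (h0 : ∀ s, γ ≤ s → G s = 0)
    (h1 : ∫⁻ s in Ioi (0 : ℝ), G s = 1) :
    ∃ f : ℝ → ℝ, IsProfile γ f ∧ ∀ᵐ s, G s = ENNReal.ofReal (f s) := by
  set H : ℝ → ℝ≥0∞ := fun s => ⨆ s' ∈ Ioi s, G s' with hH
  have hHle : ∀ s, H s ≤ ENNReal.ofReal γ := fun s => iSup₂_le fun s' _ => hle s'
  have hfin : ∀ s, H s ≠ ⊤ := fun s => ne_top_of_le_ne_top ENNReal.ofReal_ne_top (hHle s)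
  have hanti : Antitone H := fun a b hab =>
    iSup₂_le fun s' hs' => le_iSup₂_of_le s' (lt_of_le_of_lt hab hs') le_rfl
  have hH0 : ∀ s, γ ≤ s → H s = 0 := fun s hs =>
    le_antisymm (iSup₂_le fun s' hs' => (h0 s' (hs.trans (mem_Ioi.1 hs').le)).le) zero_le
  have hGH : ∀ᵐ s, G s = H s := by
    have hcount : volume {s | ¬ ContinuousAt G s} = 0 := hG.countable_not_continuousAt.measure_zero _
    filter_upwards [ae_iff.2 hcount] with s hs
    refine le_antisymm ?_ (iSup₂_le fun s' hs' => hG (mem_Ioi.1 hs').le)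
    refine le_of_tendsto (hs.tendsto.mono_left (nhdsWithin_le_nhds (s := Ioi s))) ?_
    filter_upwards [self_mem_nhdsWithin] with s' hs' using le_iSup₂_of_le s' hs' le_rfl
  have hγ : 0 ≤ γ := by
    by_contra hneg
    have : ∫⁻ s in Ioi (0 : ℝ), G s = 0 := by
      simp [fun s => le_antisymm ((hle s).trans (ENNReal.ofReal_of_nonpos (not_le.1 hneg).le).le)
        zero_le]
    exact zero_ne_one (this.symm.trans h1)
  refine ⟨fun s => (H s).toReal, ⟨fun a b hab => ENNReal.toReal_mono (hfin a) (hanti hab),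
    fun s => ENNReal.toReal_nonneg, fun s => ENNReal.toReal_le_of_le_ofReal hγ (hHle s),
    fun s hs => by simp [hH0 s hs], fun a v hv => ?_, ?_⟩, ?_⟩
  · rcases lt_or_ge v 0 with hv0 | hv0
    · exact ⟨a + 1, by simp, hv0.trans_le ENNReal.toReal_nonneg⟩
    · rw [← ENNReal.ofReal_lt_iff_lt_toReal hv0 (hfin a)] at hv
      simp only [hH, lt_iSup_iff] at hv
      obtain ⟨s', hs', hvs⟩ := hv
      obtain ⟨a', ha, ha'⟩ := exists_between (mem_Ioi.1 hs')
      refine ⟨a', ha, ?_⟩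
      rw [← ENNReal.ofReal_lt_iff_lt_toReal hv0 (hfin a')]
      exact hvs.trans_le (le_iSup₂_of_le s' ha' le_rfl)
  · rw [← h1]
    refine lintegral_congr_ae (ae_restrict_of_ae ?_)
    filter_upwards [hGH] with s hs
    rw [hs, ENNReal.ofReal_toReal (hfin s)]
  · filter_upwards [hGH] with s hs
    rw [hs, ENNReal.ofReal_toReal (hfin s)]

theorem exists_profile {n : ℕ} (hn : n ≠ 0) {γ : ℝ} {A : ℕ → Set (Sp n)}
    (hAm : ∀ k, MeasurableSet (A k)) (hAvol : Tendsto (fun k => volume (A k)) atTop (nhds 1))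
    (hAn : ∀ k, IsNormalized γ (A k)) {E : Set (Sp n)} (hE : MeasurableSet E)
    (h : Tendsto (fun k => volume (symmDiff (natSymm (A k)) E)) atTop (nhds 0)) :
    ∃ f : ℝ → ℝ, IsProfile γ f ∧ Tendsto (fun k => volume (symmDiff (natSymm (A k))
      (ballStack n fun s => ENNReal.ofReal (f s)))) atTop (nhds 0) := by
  have hNm : ∀ k, MeasurableSet (natSymm (A k)) := fun k =>
    measurableSet_natSymm hn (A k)
  simp only [fun k => volume_symmDiff_eq_lintegral (hNm k) hE] at h
  obtain ⟨ns, hns, hae⟩ := exists_seq_tendsto_ae_of_tendsto_lintegral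
    (fun k => measurable_volume_symmDiff_hslice (hNm k) hE) h
  set G : ℝ → ℝ≥0∞ := fun s => liminf (fun k => levelVolume (A (ns k)) s) atTop with hG
  have hlev : ∀ k s, volume (hslice (natSymm (A k)) s) = levelVolume (A k) (2 * |s|) := by
    intro k s
    rw [natSymm_eq_ballStack, hslice_ballStack]
    exact volume_centeredBall hn (ne_top_of_le_ne_top ENNReal.ofReal_ne_top ((hAn k).levelVolume_le _))
  have hlim : ∀ᵐ y : ℝ, Tendsto (fun k => levelVolume (A (ns k)) (2 * |y|)) atTop
      (nhds (G (2 * |y|))) := by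
    filter_upwards [hae] with y hy
    have hEy : volume (hslice E y) ≠ ⊤ := by
      obtain ⟨k, hk⟩ := (hy.eventually (Iio_mem_nhds zero_lt_one)).exists
      refine ne_top_of_le_ne_top ?_
        (volume_le_add_volume_symmDiff (hslice E y) (hslice (natSymm (A (ns k))) y))
      rw [symmDiff_comm, hlev]
      exact ENNReal.add_ne_top.2
        ⟨ne_top_of_le_ne_top ENNReal.ofReal_ne_top ((hAn _).levelVolume_le _), hk.ne_top⟩
    have := tendsto_measure_of_tendsto_symmDiff hEy hy
    simp only [hlev] at this
    rwa [show G (2 * |y|) = _ from this.liminf_eq]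
  have hmass : ∫⁻ s in Ioi (0 : ℝ), G s = 1 := by
    have h1 := tendsto_lintegral_of_dominated_convergence (μ := volume.restrict (Ioi (0 : ℝ)))
      (F := fun k => levelVolume (A (ns k))) (f := G)
      ((Iio γ).indicator fun _ => ENNReal.ofReal γ) (fun k => measurable_levelVolume _)
      (fun k => Eventually.of_forall fun s => by
        by_cases hs : s < γ
        · rw [indicator_of_mem (mem_Iio.2 hs)]
          exact (hAn _).levelVolume_le s
        · rw [(hAn _).levelVolume_eq_zero (not_lt.1 hs)]
          exact zero_le)
      (by
        rw [lintegral_indicator measurableSet_Iio, lintegral_const, Measure.restrict_restrict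
          measurableSet_Iio, Measure.restrict_apply_univ, Iio_inter_Ioi, Real.volume_Ioo]
        exact ENNReal.mul_ne_top ENNReal.ofReal_ne_top ENNReal.ofReal_ne_top)
      (ae_restrict_Ioi_of_ae_two_mul_abs hlim)
    simp only [fun k => lintegral_levelVolume (hAm (ns k))] at h1
    exact tendsto_nhds_unique h1 (hAvol.comp hns.tendsto_atTop)
  obtain ⟨f, hf, hfG⟩ := exists_rightContinuous (G := G) (γ := γ)
    (fun a b hab => liminf_le_liminf (Eventually.of_forall fun k => antitone_levelVolume _ hab))
    (fun s => (liminf_le_liminf (Eventually.of_forall fun k => (hAn _).levelVolume_le s)).trans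
      (liminf_const _).le)
    (fun s hs => by simp [hG, fun k => (hAn (ns k)).levelVolume_eq_zero hs]) hmass
  have hCm := measurableSet_ballStack hn hf.measurable
  have hEC : volume (symmDiff E (ballStack n fun s => ENNReal.ofReal (f s))) = 0 := by
    rw [volume_symmDiff_eq_lintegral hE hCm, lintegral_eq_zero_iff
      (measurable_volume_symmDiff_hslice hE hCm)]
    filter_upwards [hae, hlim, ae_two_mul_abs hfG] with y h1 h2 h3
    rw [h3] at h2
    have h4 := h1.add (tendsto_sub_add_sub ENNReal.ofReal_ne_top h2)
    rw [add_zero] at h4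
    refine le_antisymm (ge_of_tendsto' h4 fun k => ?_) zero_le
    refine (volume_symmDiff_triangle _ (hslice (natSymm (A (ns k))) y) _).trans ?_
    rw [symmDiff_comm]
    refine add_le_add le_rfl (volume_symmDiff_centeredBall_le hn ?_ ENNReal.ofReal_ne_top)
    exact ne_top_of_le_ne_top ENNReal.ofReal_ne_top ((hAn _).levelVolume_le _)
  refine ⟨f, hf, ?_⟩
  simp only [← fun k => volume_symmDiff_eq_lintegral (hNm k) hE] at h
  refine tendsto_of_tendsto_of_tendsto_of_le_of_le tendsto_const_nhds h (fun _ => zero_le)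
    fun k => ?_
  simpa [hEC] using volume_symmDiff_triangle (natSymm (A k)) E
    (ballStack n fun s => ENNReal.ofReal (f s))

theorem IsProfile.eventually_lt_levelVolume {n : ℕ} (hn : n ≠ 0) {γ : ℝ} {f : ℝ → ℝ}
    (hf : IsProfile γ f) {A : ℕ → Set (Sp n)} (hAn : ∀ k, IsNormalized γ (A k))
    (h : Tendsto (fun k => volume (symmDiff (natSymm (A k))
      (ballStack n fun s => ENNReal.ofReal (f s)))) atTop (nhds 0))
    {s v : ℝ} (hs : 0 ≤ s) (hv : 0 ≤ v) (hvs : v < f s) :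
    ∀ᶠ k in atTop, ENNReal.ofReal v < levelVolume (A k) s := by
  obtain ⟨s', hs', hvs'⟩ := hf.exists_gt s v hvs
  have hpos : 0 < ENNReal.ofReal (f s' - v) * ENNReal.ofReal (s' / 2 - s / 2) :=
    ENNReal.mul_pos (by simpa using hvs') (by simp; linarith)
  filter_upwards [h.eventually (Iio_mem_nhds hpos)] with k hk
  by_contra hle
  refine hk.not_ge ?_
  rw [volume_symmDiff_eq_lintegral (measurableSet_natSymm hn (A k))
    (measurableSet_ballStack hn hf.measurable), ← Real.volume_Ioo (a := s / 2) (b := s' / 2), ← setLIntegral_const]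
  refine (setLIntegral_mono' measurableSet_Ioo fun y hy => ?_).trans (setLIntegral_le_lintegral _ _)
  have hy0 : 0 < y := lt_of_le_of_lt (by positivity) hy.1
  have hbound := volume_le_add_volume_symmDiff
    (hslice (ballStack n fun s => ENNReal.ofReal (f s)) y) (hslice (natSymm (A k)) y)
  have e1 : volume (hslice (ballStack n fun s => ENNReal.ofReal (f s)) y) =
    ENNReal.ofReal (f (2 * |y|)) := by
    rw [hslice_ballStack]
    exact volume_centeredBall hn ENNReal.ofReal_ne_top
  have e2 : volume (hslice (natSymm (A k)) y) = levelVolume (A k) (2 * |y|) := by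
    rw [natSymm_eq_ballStack, hslice_ballStack]
    exact volume_centeredBall hn (ne_top_of_le_ne_top ENNReal.ofReal_ne_top ((hAn k).levelVolume_le _))
  rw [e1, e2, symmDiff_comm, abs_of_pos hy0] at hbound
  rw [ENNReal.ofReal_sub _ hv, tsub_le_iff_left]
  calc ENNReal.ofReal (f s') ≤ ENNReal.ofReal (f (2 * y)) :=
        ENNReal.ofReal_le_ofReal (hf.antitone (by linarith [hy.2]))
    _ ≤ _ := hbound
    _ ≤ _ := by
      gcongr
      exact (antitone_levelVolume _ (by linarith [hy.1])).trans (not_lt.1 hle)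

theorem rootMean_le_levelVolume {n : ℕ} (hn : n ≠ 0) {t : ℝ} (ht0 : 0 < t) (ht1 : t < 1)
    {A B M : Set (Sp n)} (hA : MeasurableSet A) (hB : MeasurableSet B)
    (hM : t • A + (1 - t) • B ⊆ M) {a b v w : ℝ} (ha : 0 ≤ a) (hb : 0 ≤ b) (hv : 0 ≤ v)
    (hw : 0 ≤ w) (hva : ENNReal.ofReal v < levelVolume A a)
    (hwb : ENNReal.ofReal w < levelVolume B b) :
    ENNReal.ofReal (rootMean n t v w) ≤ levelVolume M (t * a + (1 - t) * b) := by
  have hs : 0 < 1 - t := by linarith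
  refine (brunn_minkowski hn ht0 ht1 (measurableSet_lt measurable_const
    (measurable_volume_vslice hA)) (measurableSet_lt measurable_const
    (measurable_volume_vslice hB)) hv hw hva hwb).trans (measure_mono ?_)
  rintro _ ⟨_, ⟨x, hx, rfl⟩, _, ⟨y, hy, rfl⟩, rfl⟩
  have hx : ENNReal.ofReal a < volume (vslice A x) := hx
  have hy : ENNReal.ofReal b < volume (vslice B y) := hy
  have hsub : t • vslice A x + (1 - t) • vslice B y ⊆ vslice M (t • x + (1 - t) • y) := by
    rintro _ ⟨_, ⟨p, hp, rfl⟩, _, ⟨q, hq, rfl⟩, rfl⟩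
    exact hM ⟨t • (x, p), ⟨(x, p), hp, rfl⟩, (1 - t) • (y, q), ⟨(y, q), hq, rfl⟩, rfl⟩
  have h1D := volume_add_le_volume_smul_add_smul (measurable_prodMk_left hA)
    (measurable_prodMk_left hB) (nonempty_of_measure_ne_zero (zero_le.trans_lt hx).ne')
    (nonempty_of_measure_ne_zero (zero_le.trans_lt hy).ne') ht0 ht1
  refine lt_of_lt_of_le ?_ (h1D.trans (measure_mono hsub))
  rw [ENNReal.ofReal_add (by positivity) (by positivity), ENNReal.ofReal_mul ht0.le,
    ENNReal.ofReal_mul hs.le]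
  exact ENNReal.add_lt_add
    ((ENNReal.mul_lt_mul_iff_right (by simpa using ht0) ENNReal.ofReal_ne_top).2 hx)
    ((ENNReal.mul_lt_mul_iff_right (by simpa using hs) ENNReal.ofReal_ne_top).2 hy)

theorem isRootMeanBound_liminf_levelVolume {n : ℕ} (hn : n ≠ 0) {γ t₀ : ℝ} {t : ℕ → ℝ}
    (ht : ∀ k, t k ∈ Ioo (0 : ℝ) 1) (htt : Tendsto t atTop (nhds t₀)) {A B M : ℕ → Set (Sp n)}
    (hA : ∀ k, MeasurableSet (A k)) (hB : ∀ k, MeasurableSet (B k))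
    (hM : ∀ k, t k • A k + (1 - t k) • B k ⊆ M k) {f g : ℝ → ℝ} (hf : IsProfile γ f)
    (hg : IsProfile γ g)
    (hfA : ∀ s v, 0 ≤ s → 0 ≤ v → v < f s → ∀ᶠ k in atTop, ENNReal.ofReal v < levelVolume (A k) s)
    (hgB : ∀ s v, 0 ≤ s → 0 ≤ v → v < g s →
      ∀ᶠ k in atTop, ENNReal.ofReal v < levelVolume (B k) s) :
    IsRootMeanBound n t₀ f g fun z => liminf (fun k => levelVolume (M k) z) atTop := by
  intro a b v w ha hb hv hw hva hwb
  obtain ⟨a', ha', hva'⟩ := hf.exists_gt a v hva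
  obtain ⟨b', hb', hwb'⟩ := hg.exists_gt b w hwb
  have ht₀ : t₀ ∈ Icc (0 : ℝ) 1 :=
    isClosed_Icc.mem_of_tendsto htt (Eventually.of_forall fun k => Ioo_subset_Icc_self (ht k))
  have hlt : t₀ * a + (1 - t₀) * b < t₀ * a' + (1 - t₀) * b' := by
    rcases ht₀.1.eq_or_lt with h | h
    · rw [← h]; simpa using hb'
    · nlinarith [mul_pos h (sub_pos.2 ha'),
        mul_nonneg (sub_nonneg.2 ht₀.2) (sub_pos.2 hb').le]
  have hcomb : Tendsto (fun k => t k * a' + (1 - t k) * b') atTop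
      (nhds (t₀ * a' + (1 - t₀) * b')) :=
    (htt.mul_const a').add ((htt.const_sub 1).mul_const b')
  have hroot : Tendsto (fun k => ENNReal.ofReal (rootMean n (t k) v w)) atTop
      (nhds (ENNReal.ofReal (rootMean n t₀ v w))) :=
    (ENNReal.continuous_ofReal.tendsto _).comp
      (((htt.mul_const _).add ((htt.const_sub 1).mul_const _)).pow n)
  rw [← hroot.liminf_eq]
  refine liminf_le_liminf ?_
  filter_upwards [hfA a' v (ha.trans ha'.le) hv hva', hgB b' w (hb.trans hb'.le) hw hwb',
    hcomb.eventually (Ioi_mem_nhds hlt)] with k h1 h2 h3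
  exact (rootMean_le_levelVolume hn (ht k).1 (ht k).2 (hA k) (hB k) (hM k) (ha.trans ha'.le)
    (hb.trans hb'.le) hv hw h1 h2).trans (antitone_levelVolume _ h3.le)

theorem lintegral_liminf_levelVolume_le {n : ℕ} {S : ℕ → Set (Sp n)}
    (hS : ∀ k, MeasurableSet (S k)) (h : Tendsto (fun k => volume (S k)) atTop (nhds 1)) :
    ∫⁻ z in Ioi (0 : ℝ), liminf (fun k => levelVolume (S k) z) atTop ≤ 1 := by
  refine (lintegral_liminf_le fun k => measurable_levelVolume (S k)).trans ?_
  simp only [fun k => lintegral_levelVolume (hS k)]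
  exact h.liminf_eq.le

/-- If `(A_ν, B_ν)` are `γ`-normalized Borel sets with `|A_ν| → 1`, `|B_ν| → 1`,
`|t_ν A_ν + (1-t_ν)B_ν| → 1` for a convergent sequence `t_ν` in a compact `Λ ⊂ (0,1)`, and
the indicators of `A_ν^♮` and `B_ν^♮` converge in `L²`, then there is a `γ`-normalized convex
set `𝒞` with `|𝒞 ∆ 𝒞^♮| = 0` such that `|A_ν^♮ ∆ 𝒞| → 0` and `|B_ν^♮ ∆ 𝒞| → 0`. -/
theorem natSymm_limit_convex
    (d : ℕ) (hd : 2 ≤ d) (Λ : Set ℝ) (hΛc : IsCompact Λ) (hΛ : Λ ⊆ Set.Ioo (0:ℝ) 1)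
    (γ : ℝ) (hγ : 1 ≤ γ)
    (A B : ℕ → Set (Sp (d-1))) (t : ℕ → ℝ)
    (hAm : ∀ ν, MeasurableSet (A ν)) (hBm : ∀ ν, MeasurableSet (B ν))
    (htΛ : ∀ ν, t ν ∈ Λ) (htconv : ∃ t₀ : ℝ, Filter.Tendsto t Filter.atTop (nhds t₀))
    (hAvol : Filter.Tendsto (fun ν => volume (A ν)) Filter.atTop (nhds 1))
    (hBvol : Filter.Tendsto (fun ν => volume (B ν)) Filter.atTop (nhds 1))
    (hSvol : Filter.Tendsto (fun ν => volume (t ν • A ν + (1 - t ν) • B ν))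
      Filter.atTop (nhds 1))
    (hAn : ∀ ν, IsNormalized γ (A ν)) (hBn : ∀ ν, IsNormalized γ (B ν))
    (hAL2 : ∃ (fA : ℕ → Lp ℝ 2 (volume : Measure (Sp (d-1)))) (fAlim : Lp ℝ 2 (volume : Measure (Sp (d-1)))),
      (∀ ν, (fA ν : Sp (d-1) → ℝ) =ᵐ[volume] Set.indicator (natSymm (A ν)) 1) ∧
      Filter.Tendsto fA Filter.atTop (nhds fAlim))
    (hBL2 : ∃ (fB : ℕ → Lp ℝ 2 (volume : Measure (Sp (d-1)))) (fBlim : Lp ℝ 2 (volume : Measure (Sp (d-1)))),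
      (∀ ν, (fB ν : Sp (d-1) → ℝ) =ᵐ[volume] Set.indicator (natSymm (B ν)) 1) ∧
      Filter.Tendsto fB Filter.atTop (nhds fBlim)) :
    ∃ 𝒞 : Set (Sp (d-1)), Convex ℝ 𝒞 ∧ IsNormalized γ 𝒞 ∧
      volume (symmDiff 𝒞 (natSymm 𝒞)) = 0 ∧
      Filter.Tendsto (fun ν => volume (symmDiff (natSymm (A ν)) 𝒞)) Filter.atTop (nhds 0) ∧
      Filter.Tendsto (fun ν => volume (symmDiff (natSymm (B ν)) 𝒞)) Filter.atTop (nhds 0) := by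
  have hn : d - 1 ≠ 0 := by omega
  obtain ⟨t₀, ht⟩ := htconv
  have ht₀ := hΛ (hΛc.isClosed.mem_of_tendsto ht (Eventually.of_forall htΛ))
  obtain ⟨fA, fAlim, hfA, hfAlim⟩ := hAL2
  obtain ⟨fB, fBlim, hfB, hfBlim⟩ := hBL2
  obtain ⟨E, hE, hAE⟩ := exists_tendsto_measure_symmDiff_of_tendsto_Lp hfA hfAlim
  obtain ⟨E', hE', hBE⟩ := exists_tendsto_measure_symmDiff_of_tendsto_Lp hfB hfBlim
  obtain ⟨f, hf, hAf⟩ := exists_profile hn hAm hAvol hAn hE hAE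
  obtain ⟨g, hg, hBg⟩ := exists_profile hn hBm hBvol hBn hE' hBE
  have H := isRootMeanBound_liminf_levelVolume hn (fun k => hΛ (htΛ k)) ht hAm hBm
    (fun k => subset_toMeasurable volume (t k • A k + (1 - t k) • B k)) hf hg
    (fun _ _ => hf.eventually_lt_levelVolume hn hAn hAf)
    (fun _ _ => hg.eventually_lt_levelVolume hn hBn hBg)
  have hk : Measurable fun z => liminf (fun k =>
      levelVolume (toMeasurable volume (t k • A k + (1 - t k) • B k)) z) atTop :=
    Measurable.liminf fun k => measurable_levelVolume _
  have hk1 := lintegral_liminf_levelVolume_le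
    (fun k => measurableSet_toMeasurable volume (t k • A k + (1 - t k) • B k))
    (by simpa only [measure_toMeasurable] using hSvol)
  have hfg : ballStack (d - 1) (fun s => ENNReal.ofReal (g s)) =
      ballStack (d - 1) fun s => ENNReal.ofReal (f s) := by
    ext p
    rw [IsProfile.mem_ballStack_iff hn, IsProfile.mem_ballStack_iff hn,
      H.profile_eq hn ht₀.1 ht₀.2 hf hg hk hk1 (by positivity)]
  refine ⟨ballStack (d - 1) fun s => ENNReal.ofReal (f s),
    hf.convex_ballStack hn ht₀.1 ht₀.2 fun a b v w ha hb hv hw =>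
      H.rootMean_lt hn ht₀.1 ht₀.2 hf hg hk hk1 ha hb hv hw,
    hf.isNormalized_ballStack hn hγ, ?_, hAf, ?_⟩
  · rw [hf.natSymm_ballStack hn, symmDiff_self, bot_eq_empty, measure_empty]
  · rwa [hfg] at hBg
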